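/- arXiv:2209.10575 — 3 statements merged into one kernel-verified Lean document; each statement's English description precedes it below -/
import Mathlib

section
/- Let μ ≥ 0, η > η̄, and (β̃,γ̃) ∈ ℝ^p × ℝ^q. Then (β̂,γ̂) = S_{η,μ}(β̃,γ̃) if and only if γ̂ ∈ ℝ_+^q and there exists v̂ ∈ ℝ_+^q with G_{η,μ}((β̂,γ̂,v̂),(β̃,γ̃)) = 0; moreover such v̂ is unique, and when μ > 0 it is given componentwise by v̂_j = μ/γ̂_j (i.e., v̂ = −∇φ_μ(γ̂)). -/
open Matrix Real Filter Topology Bornology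
open scoped Pointwise

noncomputable section

abbrev Vec (k : ℕ) : Type := Fin k → ℝ

/-- Euclidean norm of a vector. -/
def eNorm {ι : Type*} [Fintype ι] (x : ι → ℝ) : ℝ := Real.sqrt (∑ j, (x j) ^ 2)

/-- Squared Euclidean norm of a pair of vectors. -/
def sqnorm2 {p q : ℕ} (w : Vec p × Vec q) : ℝ :=
  (∑ j, (w.1 j) ^ 2) + ∑ j, (w.2 j) ^ 2

/-- ℓ²→ℓ² operator norm of a matrix (its largest singular value). -/
def opNorm {ι κ : Type*} [Fintype ι] [Fintype κ] (M : Matrix ι κ ℝ) : ℝ :=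
  sInf {c : ℝ | 0 ≤ c ∧ ∀ x : κ → ℝ, eNorm (M.mulVec x) ≤ c * eNorm x}

/-- Smallest eigenvalue of a symmetric matrix, via Rayleigh quotients. -/
def minEig {ι : Type*} [Fintype ι] (M : Matrix ι ι ℝ) : ℝ :=
  sInf {r : ℝ | ∃ x : ι → ℝ, eNorm x = 1 ∧ r = x ⬝ᵥ M.mulVec x}

/-- Largest eigenvalue of a symmetric matrix, via Rayleigh quotients. -/
def maxEig {ι : Type*} [Fintype ι] (M : Matrix ι ι ℝ) : ℝ :=
  sSup {r : ℝ | ∃ x : ι → ℝ, eNorm x = 1 ∧ r = x ⬝ᵥ M.mulVec x}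

/-- The log-barrier (perspective of the negative log). -/
def phiBar (μ : ℝ) {q : ℕ} (γ : Vec q) : EReal :=
  if μ = 0 then (if ∀ j, 0 ≤ γ j then (0 : EReal) else ⊤)
  else if 0 < μ then
    (if ∀ j, 0 < γ j then (((-μ) * ∑ j, Real.log (γ j / μ) : ℝ) : EReal) else ⊤)
  else ⊤

/-- The coupling function κ_η. -/
def kappaFun (η : ℝ) {p q : ℕ} (w : Vec p × Vec q) : ℝ := η / 2 * sqnorm2 w

/-- 1-coercivity: liminf of F(w)/‖w‖ as ‖w‖ → ∞ is positive. -/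
def OneCoercive {p q : ℕ} (R : Vec p × Vec q → EReal) : Prop :=
  ∃ c : ℝ, 0 < c ∧ ∃ r : ℝ, ∀ w : Vec p × Vec q,
    r ≤ Real.sqrt (sqnorm2 w) → ((c * Real.sqrt (sqnorm2 w) : ℝ) : EReal) ≤ R w

/-- Data of a linear mixed-effects model. -/
structure LMEData (m p q : ℕ) where
  n : Fin m → ℕ
  X : ∀ i, Matrix (Fin (n i)) (Fin p) ℝ
  Z : ∀ i, Matrix (Fin (n i)) (Fin q) ℝ
  y : ∀ i, Fin (n i) → ℝ
  lam : ∀ i, Matrix (Fin (n i)) (Fin (n i)) ℝ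

namespace LMEData

variable {m p q : ℕ}

/-- Ω_i(Γ) = Z_i Γ Z_iᵀ + Λ_i. -/
def Omega (D : LMEData m p q) (Γ : Matrix (Fin q) (Fin q) ℝ) (i : Fin m) :
    Matrix (Fin (D.n i)) (Fin (D.n i)) ℝ :=
  D.Z i * Γ * (D.Z i)ᵀ + D.lam i

/-- The marginal negative log-likelihood L_ML(β, Γ). -/
def LML (D : LMEData m p q) (β : Vec p) (Γ : Matrix (Fin q) (Fin q) ℝ) : ℝ :=
  ∑ i, ((1 : ℝ) / 2 * ((D.y i - D.X i *ᵥ β) ⬝ᵥ ((D.Omega Γ i)⁻¹ *ᵥ (D.y i - D.X i *ᵥ β)))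
    + (1 : ℝ) / 2 * Real.log (D.Omega Γ i).det)

/-- L(β, γ) = L_ML(β, Diag γ). -/
def L (D : LMEData m p q) (β : Vec p) (γ : Vec q) : ℝ := D.LML β (Matrix.diagonal γ)

/-- ν = max_i (1/2) μ_min(Λ_i)^{-2} σ_max(Z_i)^4. -/
def nu (D : LMEData m p q) : ℝ :=
  ⨆ i : Fin m, (1 : ℝ) / 2 * ((minEig (D.lam i)) ^ 2)⁻¹ * (opNorm (D.Z i)) ^ 4

/-- η̄ = ν m. -/
def etabar (D : LMEData m p q) : ℝ := D.nu * m

/-- L_{η,μ}((β,γ),(β̃,γ̃)) = L(β,γ) + φ_μ(γ) + κ_η(β−β̃,γ−γ̃). -/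
def Lrelax (D : LMEData m p q) (η μ : ℝ) (x w : Vec p × Vec q) : EReal :=
  ((D.L x.1 x.2 + kappaFun η (x - w) : ℝ) : EReal) + phiBar μ x.2

/-- The optimal value function u_{η,μ} (with extended-real values). -/
def uval (D : LMEData m p q) (η μ : ℝ) (w : Vec p × Vec q) : EReal :=
  ⨅ x : Vec p × Vec q, D.Lrelax η μ x w

/-- The (real-valued) optimal value function u_{η,μ}. -/
def ufun (D : LMEData m p q) (η μ : ℝ) (w : Vec p × Vec q) : ℝ := (D.uval η μ w).toReal

/-- Partial gradient ∇_β L. -/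
def gradB (D : LMEData m p q) (β : Vec p) (γ : Vec q) : Vec p :=
  fun j => fderiv ℝ (fun b => D.L b γ) β (Pi.single j 1)

/-- Partial gradient ∇_γ L. -/
def gradG (D : LMEData m p q) (β : Vec p) (γ : Vec q) : Vec q :=
  fun j => fderiv ℝ (fun g => D.L β g) γ (Pi.single j 1)

/-- The map G_{η,μ}. -/
def Gmap (D : LMEData m p q) (η μ : ℝ) (x : Vec p × Vec q × Vec q) (w : Vec p × Vec q) :
    Vec p × Vec q × Vec q :=
  (D.gradB x.1 x.2.1 + η • (x.1 - w.1),
   D.gradG x.1 x.2.1 + η • (x.2.1 - w.2) - x.2.2,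
   fun j => x.2.2 j * x.2.1 j - μ)

/-- Second-derivative block ∇²_{ββ} L. -/
def hessBB (D : LMEData m p q) (β : Vec p) (γ : Vec q) : Matrix (Fin p) (Fin p) ℝ :=
  Matrix.of fun j k => fderiv ℝ (fun b => D.gradB b γ j) β (Pi.single k 1)

/-- Second-derivative block ∇²_{γγ} L. -/
def hessGG (D : LMEData m p q) (β : Vec p) (γ : Vec q) : Matrix (Fin q) (Fin q) ℝ :=
  Matrix.of fun j k => fderiv ℝ (fun g => D.gradG β g j) γ (Pi.single k 1)

/-- Second-derivative block ∇²_{γβ} L (the p×q cross block). -/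
def hessGB (D : LMEData m p q) (β : Vec p) (γ : Vec q) : Matrix (Fin p) (Fin q) ℝ :=
  Matrix.of fun j k => fderiv ℝ (fun g => D.gradB β g j) γ (Pi.single k 1)

/-- Second-derivative block ∇²_{βγ} L (the q×p cross block). -/
def hessBG (D : LMEData m p q) (β : Vec p) (γ : Vec q) : Matrix (Fin q) (Fin p) ℝ :=
  Matrix.of fun j k => fderiv ℝ (fun b => D.gradG b γ j) β (Pi.single k 1)

end LMEData

/-- f(r, M) = (1/2)(rᵀM⁻¹r + ln det M). -/
def fRM {n : ℕ} (r : Vec n) (M : Matrix (Fin n) (Fin n) ℝ) : ℝ :=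
  (1 : ℝ) / 2 * (r ⬝ᵥ (M⁻¹ *ᵥ r) + Real.log M.det)


namespace LMEaux

theorem eNorm_sq {ι : Type*} [Fintype ι] (x : ι → ℝ) : eNorm x ^ 2 = x ⬝ᵥ x := by
  unfold eNorm
  rw [Real.sq_sqrt (Finset.sum_nonneg fun i _ => sq_nonneg _)]
  simp [dotProduct, sq]

theorem dot_self_nonneg {ι : Type*} [Fintype ι] (x : ι → ℝ) : 0 ≤ x ⬝ᵥ x := by
  rw [← eNorm_sq]; positivity

theorem cs {ι : Type*} [Fintype ι] (x y : ι → ℝ) :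
    (x ⬝ᵥ y) ^ 2 ≤ (x ⬝ᵥ x) * (y ⬝ᵥ y) := by
  have := Finset.sum_mul_sq_le_sq_mul_sq Finset.univ x y
  simpa [dotProduct, sq] using this

theorem eNorm_nonneg {ι : Type*} [Fintype ι] (x : ι → ℝ) : 0 ≤ eNorm x := Real.sqrt_nonneg _

theorem opNorm_nonneg {ι κ : Type*} [Fintype ι] [Fintype κ] (M : Matrix ι κ ℝ) :
    0 ≤ opNorm M := Real.sInf_nonneg fun _ h => h.1

theorem opNorm_bound {ι κ : Type*} [Fintype ι] [Fintype κ] (M : Matrix ι κ ℝ) (x : κ → ℝ) :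
    (M *ᵥ x) ⬝ᵥ (M *ᵥ x) ≤ opNorm M ^ 2 * (x ⬝ᵥ x) := by
  have hne : {c : ℝ | 0 ≤ c ∧ ∀ x : κ → ℝ, eNorm (M.mulVec x) ≤ c * eNorm x}.Nonempty := by
    refine ⟨Real.sqrt (∑ i, (M i) ⬝ᵥ (M i)), Real.sqrt_nonneg _, fun x => ?_⟩
    have h0 : 0 ≤ ∑ i, (M i) ⬝ᵥ (M i) := Finset.sum_nonneg fun i _ => dot_self_nonneg _
    apply (pow_le_pow_iff_left₀ (eNorm_nonneg _) (mul_nonneg (Real.sqrt_nonneg _) (eNorm_nonneg _)) two_ne_zero).1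
    rw [mul_pow, Real.sq_sqrt h0, eNorm_sq, eNorm_sq, Finset.sum_mul]
    apply Finset.sum_le_sum
    intro i _
    have := cs (M i) x
    simpa [mulVec, sq] using this
  have hb : eNorm (M *ᵥ x) ≤ opNorm M * eNorm x := by
    rcases (eNorm_nonneg x).eq_or_lt with h | h
    · obtain ⟨c, hc⟩ := hne
      have := hc.2 x
      rw [← h] at this ⊢
      simpa using this
    · rw [← div_le_iff₀ h]
      apply le_csInf hne
      intro c hc
      rw [div_le_iff₀ h]
      exact hc.2 x
  rw [← eNorm_sq, ← eNorm_sq, ← mul_pow]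
  exact pow_le_pow_left₀ (eNorm_nonneg _) hb 2

theorem opNorm_bound_tr {ι κ : Type*} [Fintype ι] [Fintype κ] (M : Matrix ι κ ℝ) (u : ι → ℝ) :
    (Mᵀ *ᵥ u) ⬝ᵥ (Mᵀ *ᵥ u) ≤ opNorm M ^ 2 * (u ⬝ᵥ u) := by
  set a := (Mᵀ *ᵥ u) ⬝ᵥ (Mᵀ *ᵥ u) with ha
  have h1 : a = u ⬝ᵥ (M *ᵥ (Mᵀ *ᵥ u)) := by
    rw [ha, Matrix.dotProduct_mulVec u, ← Matrix.mulVec_transpose]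
  have h2 : a ^ 2 ≤ (u ⬝ᵥ u) * (opNorm M ^ 2 * a) := by
    calc a ^ 2 = (u ⬝ᵥ (M *ᵥ (Mᵀ *ᵥ u))) ^ 2 := by rw [← h1]
      _ ≤ _ := cs _ _
      _ ≤ _ := mul_le_mul_of_nonneg_left (opNorm_bound _ _) (dot_self_nonneg _)
  have h3 : 0 ≤ a := dot_self_nonneg _
  rcases h3.eq_or_lt with h | h
  · rw [← h]; exact mul_nonneg (sq_nonneg _) (dot_self_nonneg _)
  · have : a * a ≤ (opNorm M ^ 2 * (u ⬝ᵥ u)) * a := by linarith [h2, sq a]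
    exact le_of_mul_le_mul_right this h

theorem minEig_spec {n : ℕ} (hn : 0 < n) (M : Matrix (Fin n) (Fin n) ℝ) (hM : M.PosDef) :
    0 < minEig M ∧ ∀ x, minEig M * (x ⬝ᵥ x) ≤ x ⬝ᵥ (M *ᵥ x) := by
  have hcont : Continuous fun x : Fin n → ℝ => eNorm x := by unfold eNorm; fun_prop
  have hcont2 : Continuous fun x : Fin n → ℝ => x ⬝ᵥ (M *ᵥ x) := by
    simp only [dotProduct, mulVec]; fun_prop
  have hK : IsCompact {x : Fin n → ℝ | eNorm x = 1} := by
    apply Metric.isCompact_of_isClosed_isBounded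
    · exact isClosed_eq hcont continuous_const
    · refine (Metric.isBounded_closedBall (x := (0 : Fin n → ℝ)) (r := 1)).subset fun x hx => ?_
      rw [mem_closedBall_zero_iff, pi_norm_le_iff_of_nonneg zero_le_one]
      intro i
      have h1 : x ⬝ᵥ x = 1 := by rw [← eNorm_sq, hx.out]; norm_num
      have h2 : x i * x i ≤ x ⬝ᵥ x :=
        Finset.single_le_sum (f := fun i => x i * x i) (fun i _ => mul_self_nonneg _)
          (Finset.mem_univ i)
      rw [Real.norm_eq_abs, abs_le_one_iff_mul_self_le_one]
      linarith
  have himg : {r : ℝ | ∃ x : Fin n → ℝ, eNorm x = 1 ∧ r = x ⬝ᵥ M.mulVec x} =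
      (fun x : Fin n → ℝ => x ⬝ᵥ (M *ᵥ x)) '' {x | eNorm x = 1} := by
    ext r; constructor
    · rintro ⟨x, h, rfl⟩; exact ⟨x, h, rfl⟩
    · rintro ⟨x, h, rfl⟩; exact ⟨x, h, rfl⟩
  have hC : IsCompact {r : ℝ | ∃ x : Fin n → ℝ, eNorm x = 1 ∧ r = x ⬝ᵥ M.mulVec x} := by
    rw [himg]; exact hK.image hcont2
  have hne : {r : ℝ | ∃ x : Fin n → ℝ, eNorm x = 1 ∧ r = x ⬝ᵥ M.mulVec x}.Nonempty := by
    refine ⟨_, Pi.single ⟨0, hn⟩ 1, ?_, rfl⟩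
    have : eNorm (Pi.single (⟨0, hn⟩ : Fin n) (1 : ℝ)) ^ 2 = 1 := by
      rw [eNorm_sq]; simp
    nlinarith [eNorm_nonneg (Pi.single (⟨0, hn⟩ : Fin n) (1 : ℝ))]
  constructor
  · obtain ⟨x, hx, hr⟩ := hC.sInf_mem hne
    have hx0 : x ≠ 0 := by
      rintro rfl
      simp [eNorm] at hx
    have := hM.dotProduct_mulVec_pos hx0
    unfold minEig
    rw [hr]
    simpa using this
  · intro x
    rcases (eNorm_nonneg x).eq_or_lt with h | h
    · have h0 : x ⬝ᵥ x = 0 := by rw [← eNorm_sq, ← h]; norm_num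
      rw [h0, mul_zero]
      simpa using hM.posSemidef.dotProduct_mulVec_nonneg x
    · have hmem : ((eNorm x)⁻¹ • x) ⬝ᵥ (M *ᵥ ((eNorm x)⁻¹ • x)) ∈
          {r : ℝ | ∃ x : Fin n → ℝ, eNorm x = 1 ∧ r = x ⬝ᵥ M.mulVec x} := by
        refine ⟨_, ?_, rfl⟩
        have : eNorm ((eNorm x)⁻¹ • x) ^ 2 = 1 := by
          rw [eNorm_sq]
          simp only [dotProduct_smul, smul_dotProduct, smul_eq_mul]
          rw [← eNorm_sq]; field_simp
        nlinarith [eNorm_nonneg ((eNorm x)⁻¹ • x)]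
      have h2 := csInf_le hC.bddBelow hmem
      simp only [mulVec_smul, dotProduct_smul, smul_dotProduct, smul_eq_mul] at h2
      change minEig M ≤ _ at h2
      rw [← eNorm_sq]
      calc minEig M * eNorm x ^ 2 ≤ _ := mul_le_mul_of_nonneg_right h2 (sq_nonneg _)
        _ = _ := by field_simp

theorem inv_bound {n : ℕ} (lam : ℝ) (hl : 0 < lam) (M : Matrix (Fin n) (Fin n) ℝ)
    (hM : M.PosDef) (h : ∀ x, lam * (x ⬝ᵥ x) ≤ x ⬝ᵥ (M *ᵥ x)) (u : Fin n → ℝ) :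
    lam ^ 2 * ((M⁻¹ *ᵥ u) ⬝ᵥ (M⁻¹ *ᵥ u)) ≤ u ⬝ᵥ u := by
  set s := M⁻¹ *ᵥ u with hs
  have hMs : M *ᵥ s = u := by
    rw [hs, mulVec_mulVec, Matrix.mul_nonsing_inv _ ((Matrix.isUnit_iff_isUnit_det _).1 hM.isUnit),
      one_mulVec]
  have h1 := h s
  rw [hMs] at h1
  have h2 := cs s u
  have h3 := dot_self_nonneg s
  have h4 : (lam * (s ⬝ᵥ s)) ^ 2 ≤ (s ⬝ᵥ s) * (u ⬝ᵥ u) :=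
    (pow_le_pow_left₀ (by positivity) h1 2).trans h2
  rcases h3.eq_or_lt with h | h
  · rw [← h, mul_zero]; exact dot_self_nonneg _
  · have : (lam ^ 2 * (s ⬝ᵥ s)) * (s ⬝ᵥ s) ≤ (u ⬝ᵥ u) * (s ⬝ᵥ s) := by nlinarith
    exact le_of_mul_le_mul_right this h

theorem col_bound {n q : ℕ} (lam : ℝ) (hl : 0 < lam) (M : Matrix (Fin n) (Fin n) ℝ)
    (hM : M.PosDef) (h : ∀ x, lam * (x ⬝ᵥ x) ≤ x ⬝ᵥ (M *ᵥ x)) (Z : Matrix (Fin n) (Fin q) ℝ)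
    (k : Fin q) :
    ∑ j, (Zᵀ * M⁻¹ * Z) j k ^ 2 ≤ (lam ^ 2)⁻¹ * opNorm Z ^ 4 := by
  have h1 : ∑ j, (Zᵀ * M⁻¹ * Z) j k ^ 2 =
      (Zᵀ *ᵥ (M⁻¹ *ᵥ (Z *ᵥ Pi.single k 1))) ⬝ᵥ (Zᵀ *ᵥ (M⁻¹ *ᵥ (Z *ᵥ Pi.single k 1))) := by
    rw [mulVec_mulVec, mulVec_mulVec, mulVec_single_one]
    simp [dotProduct, sq, Matrix.col]
  rw [h1]
  have e1 := opNorm_bound_tr Z (M⁻¹ *ᵥ (Z *ᵥ Pi.single k 1))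
  have e2 := inv_bound lam hl M hM h (Z *ᵥ Pi.single k 1)
  have e3 := opNorm_bound Z (Pi.single k 1)
  have e4 : (Pi.single k (1:ℝ) : Fin q → ℝ) ⬝ᵥ Pi.single k 1 = 1 := by simp
  rw [e4, mul_one] at e3
  have e5 : (M⁻¹ *ᵥ (Z *ᵥ Pi.single k 1)) ⬝ᵥ (M⁻¹ *ᵥ (Z *ᵥ Pi.single k 1)) ≤
      (lam ^ 2)⁻¹ * opNorm Z ^ 2 := by
    rw [← div_eq_inv_mul, le_div_iff₀ (by positivity)]
    linarith
  calc _ ≤ _ := e1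
    _ ≤ opNorm Z ^ 2 * ((lam ^ 2)⁻¹ * opNorm Z ^ 2) := by gcongr
    _ = _ := by ring

theorem trace_bound {n q : ℕ} (lam : ℝ) (hl : 0 < lam) (M N : Matrix (Fin n) (Fin n) ℝ)
    (hM : M.PosDef) (hMl : ∀ x, lam * (x ⬝ᵥ x) ≤ x ⬝ᵥ (M *ᵥ x))
    (hN : N.PosDef) (hNl : ∀ x, lam * (x ⬝ᵥ x) ≤ x ⬝ᵥ (N *ᵥ x)) (Z : Matrix (Fin n) (Fin q) ℝ)
    (d : Fin q → ℝ) :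
    (M⁻¹ * (Z * diagonal d * Zᵀ) * N⁻¹ * (Z * diagonal d * Zᵀ)).trace ≤
      (lam ^ 2)⁻¹ * opNorm Z ^ 4 * (d ⬝ᵥ d) := by
  set A := Zᵀ * M⁻¹ * Z with hA
  set B := Zᵀ * N⁻¹ * Z with hB
  have h1 : (M⁻¹ * (Z * diagonal d * Zᵀ) * N⁻¹ * (Z * diagonal d * Zᵀ)).trace =
      (A * diagonal d * (B * diagonal d)).trace := by
    have : M⁻¹ * (Z * diagonal d * Zᵀ) * N⁻¹ * (Z * diagonal d * Zᵀ) =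
      (M⁻¹ * Z * diagonal d * Zᵀ * N⁻¹ * Z * diagonal d) * Zᵀ := by
      simp only [Matrix.mul_assoc]
    rw [this, trace_mul_comm]
    simp only [hA, hB, Matrix.mul_assoc]
  rw [h1]
  have h2 : (A * diagonal d * (B * diagonal d)).trace =
      ∑ j, ∑ k, (A j k * d k) * (B k j * d j) := by
    rw [Matrix.trace]
    refine Finset.sum_congr rfl fun j _ => ?_
    rw [diag_apply, Matrix.mul_apply]
    refine Finset.sum_congr rfl fun k _ => ?_
    rw [mul_diagonal, mul_diagonal]
  rw [h2]
  have h3 : ∑ j, ∑ k, (A j k * d k) * (B k j * d j) ≤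
      ∑ j, ∑ k, (1/2 * (A j k ^ 2 * d k ^ 2) + 1/2 * (B k j ^ 2 * d j ^ 2)) := by
    gcongr with j _ k _
    nlinarith [sq_nonneg (A j k * d k - B k j * d j)]
  have h4 : ∑ j, ∑ k, A j k ^ 2 * d k ^ 2 ≤ (lam ^ 2)⁻¹ * opNorm Z ^ 4 * (d ⬝ᵥ d) := by
    rw [Finset.sum_comm]
    simp only [dotProduct, Finset.mul_sum, ← Finset.sum_mul]
    gcongr with k _
    · exact col_bound lam hl M hM hMl Z k
    · exact (sq _).le
  have h5 : ∑ j, ∑ k, B k j ^ 2 * d j ^ 2 ≤ (lam ^ 2)⁻¹ * opNorm Z ^ 4 * (d ⬝ᵥ d) := by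
    simp only [dotProduct, Finset.mul_sum, ← Finset.sum_mul]
    gcongr with k _
    · exact col_bound lam hl N hN hNl Z k
    · exact (sq _).le
  refine h3.trans ?_
  simp only [Finset.sum_add_distrib, ← Finset.mul_sum]
  linarith

/-- derivative of det along a line -/
theorem hasDerivAt_logdet {n : ℕ} (M N : Matrix (Fin n) (Fin n) ℝ) (t : ℝ)
    (h : 0 < (M + t • N).det) :
    HasDerivAt (fun s : ℝ => Real.log (M + s • N).det) ((M + t • N)⁻¹ * N).trace t := by
  set P := M + t • N with hP
  have hu : IsUnit P.det := h.ne'.isUnit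
  have hdet : ∀ s : ℝ, (M + s • N).det = P.det * (1 + (s - t) • (P⁻¹ * N)).det := by
    intro s
    rw [← det_mul, mul_add, mul_one, Matrix.mul_smul, Matrix.mul_nonsing_inv_cancel_left _ _ hu]
    congr 1
    rw [hP, sub_smul]; abel
  set R := (det (1 + (Polynomial.X : Polynomial ℝ) • (P⁻¹ * N).map Polynomial.C)).divX.divX
  have hd : HasDerivAt (fun s : ℝ => (M + s • N).det) (P.det * (P⁻¹ * N).trace) t := by
    have h1 : (fun s : ℝ => (M + s • N).det) = fun s => P.det *
        (1 + (P⁻¹ * N).trace * (s - t) + R.eval (s - t) * (s - t) ^ 2) := by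
      funext s; rw [hdet, det_one_add_smul]
    rw [h1]
    have hs : HasDerivAt (fun s : ℝ => s - t) 1 t := (hasDerivAt_id t).sub_const t
    have hR : HasDerivAt (fun s : ℝ => R.eval (s - t)) (R.derivative.eval (t - t) * 1) t :=
      HasDerivAt.comp (h₂ := fun x => R.eval x) (h := fun s : ℝ => s - t) t
        (R.hasDerivAt (t - t)) hs
    have := (((hs.const_mul (P⁻¹ * N).trace).const_add 1).add (hR.mul (hs.pow 2))).const_mul P.det
    refine this.congr_deriv ?_
    simp
  have := hd.log h.ne'
  refine this.congr_deriv ?_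
  change P.det * _ / P.det = _
  field_simp

theorem logdet_ineq {n : ℕ} (M N : Matrix (Fin n) (Fin n) ℝ) (C : ℝ)
    (hpd : ∀ t ∈ Set.Icc (0:ℝ) 1, 0 < (M + t • N).det)
    (hC : ∀ t ∈ Set.Icc (0:ℝ) 1, ((M + t • N)⁻¹ * N * M⁻¹ * N).trace ≤ C) :
    Real.log M.det + (M⁻¹ * N).trace - C / 2 ≤ Real.log (M + N).det := by
  let g : ℝ → ℝ := fun t => Real.log (M + t • N).det - t * (M⁻¹ * N).trace + C / 2 * t ^ 2
  have hg : ∀ t ∈ Set.Icc (0:ℝ) 1, HasDerivAt g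
      (((M + t • N)⁻¹ * N).trace - (M⁻¹ * N).trace + C * t) t := by
    intro t ht
    have h1 := hasDerivAt_logdet M N t (hpd t ht)
    have h2 := (h1.sub ((hasDerivAt_id t).mul_const (M⁻¹ * N).trace)).add
      (((hasDerivAt_id t).pow 2).const_mul (C / 2))
    refine h2.congr_deriv ?_
    simp; ring
  have hM : IsUnit M.det := by
    have := hpd 0 (by simp)
    simp at this
    exact this.ne'.isUnit
  have hmono : MonotoneOn g (Set.Icc 0 1) := by
    apply monotoneOn_of_deriv_nonneg (convex_Icc 0 1)
    · exact fun t ht => (hg t ht).continuousAt.continuousWithinAt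
    · intro t ht
      rw [interior_Icc] at ht
      exact (hg t ⟨ht.1.le, ht.2.le⟩).differentiableAt.differentiableWithinAt
    · intro t ht
      rw [interior_Icc] at ht
      have ht' : t ∈ Set.Icc (0:ℝ) 1 := ⟨ht.1.le, ht.2.le⟩
      rw [(hg t ht').deriv]
      have hP : IsUnit (M + t • N).det := (hpd t ht').ne'.isUnit
      have e : (M + t • N)⁻¹ = M⁻¹ - t • ((M + t • N)⁻¹ * N * M⁻¹) := by
        have e1 : (M + t • N)⁻¹ * (M + t • N) * M⁻¹ = M⁻¹ := by
          rw [Matrix.nonsing_inv_mul _ hP, one_mul]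
        rw [mul_add, add_mul, Matrix.mul_assoc _ M, Matrix.mul_nonsing_inv _ hM, mul_one,
          Matrix.mul_smul, Matrix.smul_mul] at e1
        exact eq_sub_of_add_eq e1
      have e2 : ((M + t • N)⁻¹ * N).trace = (M⁻¹ * N).trace -
          t * ((M + t • N)⁻¹ * N * M⁻¹ * N).trace := by
        conv_lhs => rw [e]
        rw [sub_mul, trace_sub, Matrix.smul_mul, trace_smul, smul_eq_mul]
      rw [e2]
      nlinarith [hC t ht', ht.1]
  have := hmono (by simp : (0:ℝ) ∈ Set.Icc (0:ℝ) 1) (by simp : (1:ℝ) ∈ Set.Icc (0:ℝ) 1) zero_le_one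
  simp [g] at this
  linarith

theorem posDef_inv_dot {n : ℕ} {M : Matrix (Fin n) (Fin n) ℝ} (hM : M.PosDef) (r s : Fin n → ℝ) :
    2 * (r ⬝ᵥ s) - s ⬝ᵥ (M *ᵥ s) ≤ r ⬝ᵥ (M⁻¹ *ᵥ r) := by
  set u := M⁻¹ *ᵥ r with hu
  have hMu : M *ᵥ u = r := by
    rw [hu, mulVec_mulVec, Matrix.mul_nonsing_inv _ ((Matrix.isUnit_iff_isUnit_det _).1 hM.isUnit),
      one_mulVec]
  have h := hM.posSemidef.dotProduct_mulVec_nonneg (s - u)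
  have hT : Mᵀ = M := by simpa using hM.isHermitian.eq
  have h2 : u ⬝ᵥ (M *ᵥ s) = r ⬝ᵥ s := by
    rw [dotProduct_mulVec, ← mulVec_transpose, hT, hMu]
  simp only [star_trivial, mulVec_sub, dotProduct_sub, sub_dotProduct, hMu, h2] at h
  have h3 : s ⬝ᵥ r = r ⬝ᵥ s := dotProduct_comm _ _
  have h4 : u ⬝ᵥ r = r ⬝ᵥ u := dotProduct_comm _ _
  linarith

/-- joint convexity of the matrix fractional function along a segment -/
theorem frac_convex {n : ℕ} (M N : Matrix (Fin n) (Fin n) ℝ) (r e : Fin n → ℝ) (t : ℝ)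
    (ht : t ∈ Set.Icc (0:ℝ) 1) (hM : M.PosDef) (hMN : (M + N).PosDef)
    (hMt : (M + t • N).PosDef) :
    (r + t • e) ⬝ᵥ ((M + t • N)⁻¹ *ᵥ (r + t • e)) ≤
      (1 - t) * (r ⬝ᵥ (M⁻¹ *ᵥ r)) + t * ((r + e) ⬝ᵥ ((M + N)⁻¹ *ᵥ (r + e))) := by
  set s := (M + t • N)⁻¹ *ᵥ (r + t • e) with hs
  have hMs : (M + t • N) *ᵥ s = r + t • e := by
    rw [hs, mulVec_mulVec,
      Matrix.mul_nonsing_inv _ ((Matrix.isUnit_iff_isUnit_det _).1 hMt.isUnit), one_mulVec]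
  have h1 := posDef_inv_dot hM r s
  have h2 := posDef_inv_dot hMN (r + e) s
  have h3 : s ⬝ᵥ ((M + t • N) *ᵥ s) = (r + t • e) ⬝ᵥ s := by rw [hMs, dotProduct_comm]
  simp only [add_mulVec, smul_mulVec, dotProduct_add, add_dotProduct, dotProduct_smul,
    smul_dotProduct, smul_eq_mul] at h2 h3 ⊢
  have h1' := mul_le_mul_of_nonneg_left h1 (sub_nonneg.2 ht.2)
  have h2' := mul_le_mul_of_nonneg_left h2 ht.1
  nlinarith

theorem diff_det {E : Type*} [NormedAddCommGroup E] [NormedSpace ℝ E] {n : ℕ}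
    (A : E → Matrix (Fin n) (Fin n) ℝ) (x : E)
    (h : ∀ i j, DifferentiableAt ℝ (fun x => A x i j) x) :
    DifferentiableAt ℝ (fun x => (A x).det) x := by
  simp only [det_apply]
  refine DifferentiableAt.fun_sum fun σ _ => ?_
  refine DifferentiableAt.const_smul ?_ _
  have := fun i => h (σ i) i
  fun_prop

theorem diff_inv {E : Type*} [NormedAddCommGroup E] [NormedSpace ℝ E] {n : ℕ}
    (A : E → Matrix (Fin n) (Fin n) ℝ) (x : E)
    (h : ∀ i j, DifferentiableAt ℝ (fun x => A x i j) x) (hx : (A x).det ≠ 0) (i j : Fin n) :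
    DifferentiableAt ℝ (fun x => (A x)⁻¹ i j) x := by
  have e : (fun x => (A x)⁻¹ i j) =
      fun x => ((A x).det)⁻¹ * ((A x).updateRow j (Pi.single i 1)).det := by
    funext x
    rw [Matrix.inv_def, Matrix.smul_apply, Ring.inverse_eq_inv', smul_eq_mul, adjugate_apply]
  rw [e]
  refine ((diff_det A x h).inv hx).mul (diff_det _ x fun a b => ?_)
  by_cases hab : a = j
  · subst hab
    simp
  · simpa [updateRow_ne hab] using h a b

variable {m p q : ℕ}

theorem omega_apply (D : LMEData m p q) (γ : Vec q) (i : Fin m) (a b : Fin (D.n i)) :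
    D.Omega (diagonal γ) i a b = (∑ k, D.Z i a k * γ k * D.Z i b k) + D.lam i a b := by
  unfold LMEData.Omega
  rw [Matrix.add_apply, Matrix.mul_apply]
  simp only [mul_diagonal, transpose_apply]

theorem omega_line (D : LMEData m p q) (γ d : Vec q) (t : ℝ) (i : Fin m) :
    D.Omega (diagonal (γ + t • d)) i =
      D.Omega (diagonal γ) i + t • (D.Z i * diagonal d * (D.Z i)ᵀ) := by
  ext a b
  rw [Matrix.add_apply, Matrix.smul_apply, omega_apply, omega_apply, Matrix.mul_apply]
  simp only [mul_diagonal, transpose_apply, Pi.add_apply, Pi.smul_apply, smul_eq_mul, mul_add,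
    add_mul, Finset.sum_add_distrib, Finset.mul_sum]
  have : ∑ x, D.Z i a x * (t * d x) * D.Z i b x = ∑ x, t * (D.Z i a x * d x * D.Z i b x) :=
    Finset.sum_congr rfl fun x _ => by ring
  rw [this]; ring

theorem zdz_psd (D : LMEData m p q) (γ : Vec q) (hγ : ∀ j, 0 ≤ γ j) (i : Fin m) :
    (D.Z i * diagonal γ * (D.Z i)ᵀ).PosSemidef := by
  have := (PosSemidef.diagonal (n := Fin q) (d := γ) hγ).mul_mul_conjTranspose_same (D.Z i)
  simpa using this

theorem omega_posDef (D : LMEData m p q) (hlam : ∀ i, (D.lam i).PosDef) (γ : Vec q)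
    (hγ : ∀ j, 0 ≤ γ j) (i : Fin m) : (D.Omega (diagonal γ) i).PosDef :=
  PosDef.posSemidef_add (zdz_psd D γ hγ i) (hlam i)

theorem omega_lower (D : LMEData m p q) (hn : ∀ i, 0 < D.n i) (hlam : ∀ i, (D.lam i).PosDef)
    (γ : Vec q) (hγ : ∀ j, 0 ≤ γ j) (i : Fin m) (x : Fin (D.n i) → ℝ) :
    minEig (D.lam i) * (x ⬝ᵥ x) ≤ x ⬝ᵥ (D.Omega (diagonal γ) i *ᵥ x) := by
  have h1 := (minEig_spec (hn i) _ (hlam i)).2 x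
  have h2 := (zdz_psd D γ hγ i).dotProduct_mulVec_nonneg x
  unfold LMEData.Omega
  rw [add_mulVec, dotProduct_add]
  simp only [star_trivial] at h2
  linarith

/-- joint differentiability of `L`. -/
theorem diff_L (D : LMEData m p q) (hlam : ∀ i, (D.lam i).PosDef)
    (x : Vec p × Vec q) (hγ : ∀ j, 0 ≤ x.2 j) :
    DifferentiableAt ℝ (fun x : Vec p × Vec q => D.L x.1 x.2) x := by
  unfold LMEData.L LMEData.LML
  refine DifferentiableAt.fun_sum fun i _ => ?_
  have hdet : (D.Omega (diagonal x.2) i).det ≠ 0 := (omega_posDef D hlam x.2 hγ i).det_pos.ne'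
  have hO : ∀ a b, DifferentiableAt ℝ (fun x : Vec p × Vec q => D.Omega (diagonal x.2) i a b) x := by
    intro a b
    simp only [omega_apply]
    fun_prop
  have hI := diff_inv (fun x : Vec p × Vec q => D.Omega (diagonal x.2) i) x hO hdet
  have hD := diff_det (fun x : Vec p × Vec q => D.Omega (diagonal x.2) i) x hO
  have hr : ∀ a, DifferentiableAt ℝ (fun x : Vec p × Vec q => (D.y i - D.X i *ᵥ x.1) a) x := by
    intro a
    simp only [Pi.sub_apply, mulVec, dotProduct]
    fun_prop
  refine DifferentiableAt.add (DifferentiableAt.const_mul ?_ _)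
    (DifferentiableAt.const_mul (hD.log hdet) _)
  refine DifferentiableAt.fun_sum fun a _ => (hr a).mul ?_
  have : DifferentiableAt ℝ (fun x : Vec p × Vec q => ∑ b, (D.Omega (diagonal x.2) i)⁻¹ a b *
      (D.y i - D.X i *ᵥ x.1) b) x := DifferentiableAt.fun_sum fun b _ => (hI a b).mul (hr b)
  exact this

/-- The directional derivative of `L` expressed by the partial gradients. -/
theorem fderiv_L (D : LMEData m p q) (hlam : ∀ i, (D.lam i).PosDef)
    (x : Vec p × Vec q) (hγ : ∀ j, 0 ≤ x.2 j) (d : Vec p × Vec q) :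
    fderiv ℝ (fun x : Vec p × Vec q => D.L x.1 x.2) x d =
      D.gradB x.1 x.2 ⬝ᵥ d.1 + D.gradG x.1 x.2 ⬝ᵥ d.2 := by
  have hL := (diff_L D hlam x hγ).hasFDerivAt
  set L' := fderiv ℝ (fun x : Vec p × Vec q => D.L x.1 x.2) x with hL'
  have hB : HasFDerivAt (fun b : Vec p => D.L b x.2) (L'.comp (ContinuousLinearMap.inl ℝ _ _)) x.1 :=
    HasFDerivAt.comp (g := fun x : Vec p × Vec q => D.L x.1 x.2) (f := fun b : Vec p => (b, x.2))
      x.1 hL (hasFDerivAt_prodMk_left x.1 x.2)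
  have hG : HasFDerivAt (fun g : Vec q => D.L x.1 g) (L'.comp (ContinuousLinearMap.inr ℝ _ _)) x.2 :=
    HasFDerivAt.comp (g := fun x : Vec p × Vec q => D.L x.1 x.2) (f := fun g : Vec q => (x.1, g))
      x.2 hL (hasFDerivAt_prodMk_right x.1 x.2)
  have key : ∀ (k : ℕ) (A : Vec k →L[ℝ] ℝ) (v : Vec k),
      A v = (fun j => A (Pi.single j 1)) ⬝ᵥ v := by
    intro k A v
    conv_lhs => rw [pi_eq_sum_univ' v]
    rw [map_sum]
    refine Finset.sum_congr rfl fun j _ => ?_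
    rw [map_smul, smul_eq_mul, mul_comm]
  have e : d = ContinuousLinearMap.inl ℝ (Vec p) (Vec q) d.1 +
      ContinuousLinearMap.inr ℝ (Vec p) (Vec q) d.2 := by
    ext <;> simp
  conv_lhs => rw [e]
  rw [map_add]
  unfold LMEData.gradB LMEData.gradG
  rw [hB.fderiv, hG.fderiv, ← key, ← key]
  rfl

theorem slope_le_of_convexlike (Q : ℝ → ℝ) (c : ℝ) (hQ : HasDerivAt Q c 0)
    (h : ∀ t ∈ Set.Icc (0:ℝ) 1, Q t ≤ (1 - t) * Q 0 + t * Q 1) : c ≤ Q 1 - Q 0 := by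
  have h1 := hQ.tendsto_slope_zero_right
  refine le_of_tendsto h1 ?_
  have : Set.Ioc (0:ℝ) 1 ∈ 𝓝[>] (0:ℝ) := Ioc_mem_nhdsGT one_pos
  filter_upwards [this] with t ht
  have := h t ⟨ht.1.le, ht.2⟩
  rw [zero_add, smul_eq_mul, ← div_eq_inv_mul, div_le_iff₀ ht.1]
  linarith

theorem nu_le (D : LMEData m p q) (i : Fin m) :
    (1 : ℝ) / 2 * ((minEig (D.lam i)) ^ 2)⁻¹ * (opNorm (D.Z i)) ^ 4 ≤ D.nu :=
  le_ciSup (f := fun i => (1 : ℝ) / 2 * ((minEig (D.lam i)) ^ 2)⁻¹ * (opNorm (D.Z i)) ^ 4)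
    (Set.finite_range _).bddAbove i

/-- First-order lower bound for `L` (weak convexity). -/
theorem L_ineq (D : LMEData m p q) (hn : ∀ i, 0 < D.n i) (hlam : ∀ i, (D.lam i).PosDef)
    (x d : Vec p × Vec q) (hγ : ∀ j, 0 ≤ x.2 j) (hγ' : ∀ j, 0 ≤ x.2 j + d.2 j) :
    D.L x.1 x.2 + (D.gradB x.1 x.2 ⬝ᵥ d.1 + D.gradG x.1 x.2 ⬝ᵥ d.2)
      - D.etabar / 2 * (d.2 ⬝ᵥ d.2) ≤ D.L (x.1 + d.1) (x.2 + d.2) := by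
  have hγt : ∀ t ∈ Set.Icc (0:ℝ) 1, ∀ j, 0 ≤ (x.2 + t • d.2) j := by
    intro t ht j
    simp only [Pi.add_apply, Pi.smul_apply, smul_eq_mul]
    nlinarith [hγ j, hγ' j, ht.1, ht.2]
  let M := fun i => D.Omega (diagonal x.2) i
  let N := fun i => D.Z i * diagonal d.2 * (D.Z i)ᵀ
  let r := fun i => D.y i - D.X i *ᵥ x.1
  let e := fun i => - (D.X i *ᵥ d.1)
  have hMN : ∀ t i, D.Omega (diagonal (x.2 + t • d.2)) i = M i + t • N i :=
    fun t i => omega_line D x.2 d.2 t i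
  have hre : ∀ (t : ℝ) i, D.y i - D.X i *ᵥ (x.1 + t • d.1) = r i + t • e i := by
    intro t i
    simp only [r, e, mulVec_add, mulVec_smul, smul_neg]
    abel
  have hpd : ∀ t ∈ Set.Icc (0:ℝ) 1, ∀ i, (M i + t • N i).PosDef := by
    intro t ht i
    rw [← hMN]
    exact omega_posDef D hlam _ (hγt t ht) i
  have hpd0 : ∀ i, (M i).PosDef := omega_posDef D hlam _ hγ
  have hpd1 : ∀ i, (M i + N i).PosDef := by
    intro i
    simpa using hpd 1 (by simp) i
  let qf : Fin m → ℝ → ℝ := fun i t => (r i + t • e i) ⬝ᵥ ((M i + t • N i)⁻¹ *ᵥ (r i + t • e i))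
  let g : Fin m → ℝ → ℝ := fun i t => Real.log (M i + t • N i).det
  have hH : ∀ t : ℝ, D.L (x.1 + t • d.1) (x.2 + t • d.2) =
      ∑ i, ((1:ℝ) / 2 * qf i t + 1 / 2 * g i t) := by
    intro t
    unfold LMEData.L LMEData.LML
    refine Finset.sum_congr rfl fun i _ => ?_
    rw [hMN, hre]
  have hHd : HasDerivAt (fun t : ℝ => D.L (x.1 + t • d.1) (x.2 + t • d.2))
      (D.gradB x.1 x.2 ⬝ᵥ d.1 + D.gradG x.1 x.2 ⬝ᵥ d.2) 0 := by
    rw [← fderiv_L D hlam x hγ d]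
    have hline : HasDerivAt (fun t : ℝ => x + t • d) d 0 := by
      simpa using ((hasDerivAt_id (0:ℝ)).smul_const d).const_add x
    have hL := (diff_L D hlam x hγ).hasFDerivAt
    have hL2 : HasFDerivAt (fun x : Vec p × Vec q => D.L x.1 x.2)
      (fderiv ℝ (fun x : Vec p × Vec q => D.L x.1 x.2) x) (x + (0:ℝ) • d) := by simpa using hL
    exact HasFDerivAt.comp_hasDerivAt (f := fun t : ℝ => x + t • d) 0 hL2 hline
  have hgd : ∀ i, HasDerivAt (g i) ((M i)⁻¹ * N i).trace 0 := by
    intro i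
    have := hasDerivAt_logdet (M i) (N i) 0 (by simpa using (hpd0 i).det_pos)
    simpa [g] using this
  have hQd : HasDerivAt (fun t => ∑ i, (1:ℝ) / 2 * qf i t)
      (D.gradB x.1 x.2 ⬝ᵥ d.1 + D.gradG x.1 x.2 ⬝ᵥ d.2 -
        ∑ i, (1:ℝ) / 2 * ((M i)⁻¹ * N i).trace) 0 := by
    have h1 := hHd.sub (HasDerivAt.fun_sum (u := Finset.univ)
      fun i _ => (hgd i).const_mul ((1:ℝ) / 2))
    refine h1.congr_of_eventuallyEq (Eventually.of_forall fun t => ?_)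
    simp only [Pi.sub_apply, hH, Finset.sum_add_distrib]
    ring
  have hQ := slope_le_of_convexlike _ _ hQd (by
    intro t ht
    rw [Finset.mul_sum, Finset.mul_sum, ← Finset.sum_add_distrib]
    refine Finset.sum_le_sum fun i _ => ?_
    have := frac_convex (M i) (N i) (r i) (e i) t ht (hpd0 i) (hpd1 i) (hpd t ht i)
    simp only [qf, zero_smul, one_smul, add_zero]
    linarith)
  have hg : ∀ i, g i 0 + ((M i)⁻¹ * N i).trace - D.nu * (d.2 ⬝ᵥ d.2) ≤ g i 1 := by
    intro i
    have hl := (minEig_spec (hn i) _ (hlam i)).1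
    have h1 := logdet_ineq (M i) (N i)
      ((minEig (D.lam i) ^ 2)⁻¹ * opNorm (D.Z i) ^ 4 * (d.2 ⬝ᵥ d.2))
      (fun t ht => (hpd t ht i).det_pos) (by
        intro t ht
        refine trace_bound _ hl _ _ (hpd t ht i) ?_ (hpd0 i) ?_ (D.Z i) d.2
        · rw [← hMN]
          exact omega_lower D hn hlam _ (hγt t ht) i
        · exact omega_lower D hn hlam _ hγ i)
    have h2 := mul_le_mul_of_nonneg_right (nu_le D i) (dot_self_nonneg d.2)
    simp only [g, zero_smul, one_smul, add_zero]
    linarith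
  have hgs : ∑ i, (1:ℝ) / 2 * (g i 0 + ((M i)⁻¹ * N i).trace - D.nu * (d.2 ⬝ᵥ d.2)) ≤
      ∑ i, (1:ℝ) / 2 * g i 1 :=
    Finset.sum_le_sum fun i _ => mul_le_mul_of_nonneg_left (hg i) (by norm_num)
  have h0 := hH 0
  have h1 := hH 1
  simp only [zero_smul, one_smul, add_zero] at h0 h1
  rw [h0, h1]
  simp only [mul_sub, mul_add, Finset.sum_add_distrib, Finset.sum_sub_distrib,
    Finset.sum_const, Finset.card_univ, Fintype.card_fin, nsmul_eq_mul] at hgs ⊢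
  unfold LMEData.etabar
  linarith

theorem kappa_expand (η : ℝ) (x d w : Vec p × Vec q) :
    kappaFun η (x + d - w) = kappaFun η (x - w) + (η • (x.1 - w.1)) ⬝ᵥ d.1
      + (η • (x.2 - w.2)) ⬝ᵥ d.2 + η / 2 * (d.1 ⬝ᵥ d.1) + η / 2 * (d.2 ⬝ᵥ d.2) := by
  have key : ∀ (k : ℕ) (a b c : Vec k), ∑ j, ((a + b - c) j) ^ 2 =
      ∑ j, ((a - c) j) ^ 2 + 2 * ((a - c) ⬝ᵥ b) + b ⬝ᵥ b := by
    intro k a b c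
    simp only [dotProduct, Finset.mul_sum, ← Finset.sum_add_distrib]
    refine Finset.sum_congr rfl fun j _ => ?_
    simp only [Pi.add_apply, Pi.sub_apply]; ring
  unfold kappaFun sqnorm2
  simp only [Prod.fst_sub, Prod.snd_sub, Prod.fst_add, Prod.snd_add]
  rw [key, key, smul_dotProduct, smul_dotProduct, smul_eq_mul, smul_eq_mul]
  ring

/-- The smooth part of the objective. -/
def Fobj (D : LMEData m p q) (η : ℝ) (w x : Vec p × Vec q) : ℝ :=
  D.L x.1 x.2 + kappaFun η (x - w)

theorem etabar_nonneg (D : LMEData m p q) : 0 ≤ D.etabar := by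
  unfold LMEData.etabar LMEData.nu
  refine mul_nonneg (Real.iSup_nonneg fun i => ?_) (Nat.cast_nonneg _)
  have := opNorm_nonneg (D.Z i)
  positivity

theorem F_ineq (D : LMEData m p q) (hn : ∀ i, 0 < D.n i) (hlam : ∀ i, (D.lam i).PosDef)
    (η : ℝ) (hη : D.etabar < η)
    (w x d : Vec p × Vec q) (hγ : ∀ j, 0 ≤ x.2 j) (hγ' : ∀ j, 0 ≤ x.2 j + d.2 j) :
    Fobj D η w x + ((D.gradB x.1 x.2 + η • (x.1 - w.1)) ⬝ᵥ d.1 +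
      (D.gradG x.1 x.2 + η • (x.2 - w.2)) ⬝ᵥ d.2) ≤ Fobj D η w (x + d) := by
  have h1 := L_ineq D hn hlam x d hγ hγ'
  have h2 := kappa_expand η x d w
  have h3 := etabar_nonneg D
  have h4 := dot_self_nonneg d.1
  have h5 := dot_self_nonneg d.2
  unfold Fobj
  rw [h2, add_dotProduct, add_dotProduct]
  simp only [Prod.fst_add, Prod.snd_add]
  nlinarith [mul_nonneg (h3.trans hη.le) h4, mul_nonneg (sub_nonneg.2 hη.le) h5]

theorem F_line (D : LMEData m p q) (hlam : ∀ i, (D.lam i).PosDef)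
    (η : ℝ) (w x d : Vec p × Vec q) (hγ : ∀ j, 0 ≤ x.2 j) :
    HasDerivAt (fun t : ℝ => Fobj D η w (x + t • d))
     ((D.gradB x.1 x.2 + η • (x.1 - w.1)) ⬝ᵥ d.1 +
      (D.gradG x.1 x.2 + η • (x.2 - w.2)) ⬝ᵥ d.2) 0 := by
  have hline : HasDerivAt (fun t : ℝ => x + t • d) d 0 := by
    simpa using ((hasDerivAt_id (0:ℝ)).smul_const d).const_add x
  have hL := (diff_L D hlam x hγ).hasFDerivAt
  have hL2 : HasFDerivAt (fun x : Vec p × Vec q => D.L x.1 x.2)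
    (fderiv ℝ (fun x : Vec p × Vec q => D.L x.1 x.2) x) (x + (0:ℝ) • d) := by simpa using hL
  have h1 := HasFDerivAt.comp_hasDerivAt (f := fun t : ℝ => x + t • d) 0 hL2 hline
  rw [fderiv_L D hlam x hγ d] at h1
  have h2 : HasDerivAt (fun t : ℝ => kappaFun η (x + t • d - w))
      ((η • (x.1 - w.1)) ⬝ᵥ d.1 + (η • (x.2 - w.2)) ⬝ᵥ d.2) 0 := by
    simp only [kappa_expand, Prod.smul_fst, Prod.smul_snd, dotProduct_smul, smul_eq_mul]
    have hi := hasDerivAt_id (0:ℝ)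
    have e1 := hi.mul_const ((η • (x.1 - w.1)) ⬝ᵥ d.1)
    have e2 := hi.mul_const ((η • (x.2 - w.2)) ⬝ᵥ d.2)
    have e3 := ((hi.pow 2).mul_const (η / 2 * (d.1 ⬝ᵥ d.1)))
    have e4 := ((hi.pow 2).mul_const (η / 2 * (d.2 ⬝ᵥ d.2)))
    have := (((e1.const_add (kappaFun η (x - w))).add e2).add e3).add e4
    refine (this.congr_deriv ?_).congr_of_eventuallyEq (Eventually.of_forall fun t => ?_)
    · simp
    · simp; ring
  refine (h1.add h2).congr_deriv ?_
  rw [add_dotProduct, add_dotProduct]; ring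

theorem Gmap_zero_iff (D : LMEData m p q) (η μ : ℝ) (w x : Vec p × Vec q) (v : Vec q) :
    D.Gmap η μ (x.1, x.2, v) w = 0 ↔ D.gradB x.1 x.2 + η • (x.1 - w.1) = 0 ∧
      D.gradG x.1 x.2 + η • (x.2 - w.2) = v ∧ ∀ j, v j * x.2 j = μ := by
  unfold LMEData.Gmap
  simp only [Prod.mk_eq_zero, sub_eq_zero]
  refine and_congr Iff.rfl (and_congr Iff.rfl ?_)
  constructor
  · intro h j
    have := congrFun h j
    simp only [Pi.zero_apply, sub_eq_zero] at this
    exact this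
  · intro h
    funext j
    simp only [Pi.zero_apply, sub_eq_zero]
    exact h j

theorem Lrelax_eq (D : LMEData m p q) (η μ : ℝ) (x w : Vec p × Vec q) :
    D.Lrelax η μ x w = ((Fobj D η w x : ℝ) : EReal) + phiBar μ x.2 := rfl

theorem phi_zero {γ : Vec q} (h : ∀ j, 0 ≤ γ j) : phiBar 0 γ = 0 := by
  simp [phiBar, h]

theorem phi_zero_top {γ : Vec q} (h : ¬ ∀ j, 0 ≤ γ j) : phiBar 0 γ = ⊤ := by
  unfold phiBar; rw [if_pos rfl, if_neg h]

theorem phi_pos {μ : ℝ} (hμ : 0 < μ) {γ : Vec q} (h : ∀ j, 0 < γ j) :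
    phiBar μ γ = (((-μ) * ∑ j, Real.log (γ j / μ) : ℝ) : EReal) := by
  unfold phiBar; rw [if_neg hμ.ne', if_pos hμ, if_pos h]

theorem phi_pos_top {μ : ℝ} (hμ : 0 < μ) {γ : Vec q} (h : ¬ ∀ j, 0 < γ j) :
    phiBar μ γ = ⊤ := by
  unfold phiBar; rw [if_neg hμ.ne', if_pos hμ, if_neg h]

theorem kkt_zero_of_min (D : LMEData m p q) (hlam : ∀ i, (D.lam i).PosDef)
    (η : ℝ) (w x : Vec p × Vec q)
    (h : ∀ x' : Vec p × Vec q, D.Lrelax η 0 x w ≤ D.Lrelax η 0 x' w) :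
    (∀ j, 0 ≤ x.2 j) ∧ ∃ v : Vec q, (∀ j, 0 ≤ v j) ∧ D.Gmap η 0 (x.1, x.2, v) w = 0 := by
  have hγ : ∀ j, 0 ≤ x.2 j := by
    by_contra hc
    have h1 := h (0, 0)
    rw [Lrelax_eq, Lrelax_eq, phi_zero_top hc, phi_zero (by simp), EReal.coe_add_top, add_zero] at h1
    exact absurd (top_le_iff.1 h1) (EReal.coe_ne_top _)
  have hF : ∀ x' : Vec p × Vec q, (∀ j, 0 ≤ x'.2 j) → Fobj D η w x ≤ Fobj D η w x' := by
    intro x' hx'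
    have h1 := h x'
    rw [Lrelax_eq, Lrelax_eq, phi_zero hγ, phi_zero hx', add_zero, add_zero] at h1
    exact_mod_cast h1
  have hVI : ∀ d : Vec p × Vec q, (∀ j, 0 ≤ x.2 j + d.2 j) →
      0 ≤ (D.gradB x.1 x.2 + η • (x.1 - w.1)) ⬝ᵥ d.1 +
      (D.gradG x.1 x.2 + η • (x.2 - w.2)) ⬝ᵥ d.2 := by
    intro d hd
    refine ge_of_tendsto (F_line D hlam η w x d hγ).tendsto_slope_zero_right ?_
    have : Set.Ioc (0:ℝ) 1 ∈ 𝓝[>] (0:ℝ) := Ioc_mem_nhdsGT one_pos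
    filter_upwards [this] with t ht
    rw [zero_add, zero_smul, add_zero, smul_eq_mul]
    refine mul_nonneg (inv_nonneg.2 ht.1.le) (sub_nonneg.2 (hF _ fun j => ?_))
    simp only [Prod.snd_add, Prod.smul_snd, Pi.add_apply, Pi.smul_apply, smul_eq_mul]
    nlinarith [hγ j, hd j, ht.1, ht.2]
  refine ⟨hγ, D.gradG x.1 x.2 + η • (x.2 - w.2), fun j => ?_, ?_⟩
  · have := hVI (0, Pi.single j 1) (fun k => add_nonneg (hγ k) (by
      by_cases hk : k = j
      · subst hk; simp
      · simp [hk]))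
    simpa using this
  · rw [Gmap_zero_iff]
    refine ⟨?_, rfl, fun j => ?_⟩
    · have := hVI (-(D.gradB x.1 x.2 + η • (x.1 - w.1)), 0) (fun k => by simpa using hγ k)
      simp only [dotProduct_neg, dotProduct_zero, add_zero] at this
      have h2 := dot_self_nonneg (D.gradB x.1 x.2 + η • (x.1 - w.1))
      exact dotProduct_self_eq_zero.1 (by linarith)
    · have h1 := hVI (0, Pi.single j (x.2 j)) (fun k => add_nonneg (hγ k) (by
        by_cases hk : k = j
        · subst hk; simpa using hγ k
        · simp [hk]))
      have h2 := hVI (0, Pi.single j (-x.2 j)) (fun k => by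
        by_cases hk : k = j
        · subst hk; simp
        · simpa [hk] using hγ k)
      simp only [dotProduct_zero, dotProduct_single, zero_add] at h1 h2
      linarith

theorem kkt_pos_of_min (D : LMEData m p q) (hlam : ∀ i, (D.lam i).PosDef)
    (η μ : ℝ) (hμ : 0 < μ) (w x : Vec p × Vec q)
    (h : ∀ x' : Vec p × Vec q, D.Lrelax η μ x w ≤ D.Lrelax η μ x' w) :
    (∀ j, 0 ≤ x.2 j) ∧ ∃ v : Vec q, (∀ j, 0 ≤ v j) ∧ D.Gmap η μ (x.1, x.2, v) w = 0 := by
  have hγ : ∀ j, 0 < x.2 j := by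
    by_contra hc
    have h1 := h (0, fun _ => 1)
    rw [Lrelax_eq, Lrelax_eq, phi_pos_top hμ hc, phi_pos hμ (by simp), EReal.coe_add_top,
      ← EReal.coe_add] at h1
    exact absurd (top_le_iff.1 h1) (EReal.coe_ne_top _)
  have hF : ∀ x' : Vec p × Vec q, (∀ j, 0 < x'.2 j) →
      Fobj D η w x + (-μ) * ∑ j, Real.log (x.2 j / μ) ≤
        Fobj D η w x' + (-μ) * ∑ j, Real.log (x'.2 j / μ) := by
    intro x' hx'
    have h1 := h x'
    rw [Lrelax_eq, Lrelax_eq, phi_pos hμ hγ, phi_pos hμ hx', ← EReal.coe_add, ← EReal.coe_add] at h1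
    exact_mod_cast h1
  have hVE : ∀ d : Vec p × Vec q,
      (D.gradB x.1 x.2 + η • (x.1 - w.1)) ⬝ᵥ d.1 +
      (D.gradG x.1 x.2 + η • (x.2 - w.2)) ⬝ᵥ d.2 + (-μ) * ∑ j, d.2 j / x.2 j = 0 := by
    intro d
    have h1 := F_line D hlam η w x d fun j => (hγ j).le
    have h2 : HasDerivAt (fun t : ℝ => (-μ) * ∑ j, Real.log ((x + t • d).2 j / μ))
        ((-μ) * ∑ j, d.2 j / x.2 j) 0 := by
      refine HasDerivAt.const_mul _ (HasDerivAt.fun_sum fun j _ => ?_)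
      have e1 : HasDerivAt (fun t : ℝ => (x.2 j + t * d.2 j) / μ) (d.2 j / μ) 0 := by
        simpa using (((hasDerivAt_id (0:ℝ)).mul_const (d.2 j)).const_add (x.2 j)).div_const μ
      have e2 := e1.log (by
        have := hγ j
        simp only [zero_mul, add_zero]
        positivity)
      refine e2.congr_deriv ?_
      have := hγ j
      simp only [zero_mul, add_zero]
      field_simp
    refine IsLocalMin.hasDerivAt_eq_zero ?_ (h1.add h2)
    have hev : ∀ᶠ t : ℝ in 𝓝 0, ∀ j, 0 < (x + t • d).2 j := by
      rw [eventually_all]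
      intro j
      have hc : Continuous fun t : ℝ => (x + t • d).2 j := by
        simp only [Prod.snd_add, Prod.smul_snd, Pi.add_apply, Pi.smul_apply]
        fun_prop
      have := hc.tendsto 0
      refine this.eventually (lt_mem_nhds ?_)
      simpa using hγ j
    filter_upwards [hev] with t ht
    have := hF _ ht
    simpa using this
  refine ⟨fun j => (hγ j).le, fun j => μ / x.2 j, fun j => (div_pos hμ (hγ j)).le, ?_⟩
  rw [Gmap_zero_iff]
  refine ⟨?_, ?_, fun j => div_mul_cancel₀ _ (hγ j).ne'⟩
  · funext j
    have := hVE (Pi.single j 1, 0)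
    simpa using this
  · funext j
    have := hVE (0, Pi.single j 1)
    have e : ∑ k, (Pi.single j 1 : Vec q) k / x.2 k = 1 / x.2 j := by
      rw [Finset.sum_eq_single j]
      · simp
      · intro b _ hb; simp [hb]
      · simp
    simp only [dotProduct_zero, dotProduct_single, zero_add, mul_one, e] at this
    rw [div_eq_mul_one_div]
    linarith

theorem min_of_kkt (D : LMEData m p q) (hn : ∀ i, 0 < D.n i) (hlam : ∀ i, (D.lam i).PosDef)
    (η μ : ℝ) (hμ : 0 ≤ μ) (hη : D.etabar < η) (w x : Vec p × Vec q)
    (hγ : ∀ j, 0 ≤ x.2 j) (v : Vec q) (hv : ∀ j, 0 ≤ v j)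
    (hG : D.Gmap η μ (x.1, x.2, v) w = 0) (x' : Vec p × Vec q) :
    D.Lrelax η μ x w ≤ D.Lrelax η μ x' w := by
  rw [Gmap_zero_iff] at hG
  obtain ⟨h1, h2, h3⟩ := hG
  have key : (∀ j, 0 ≤ x'.2 j) → Fobj D η w x + ∑ j, v j * (x'.2 j - x.2 j) ≤ Fobj D η w x' := by
    intro hx'
    have := F_ineq D hn hlam η hη w x (x' - x) hγ (fun j => by simpa using hx' j)
    rw [h1, h2, zero_dotProduct, zero_add, add_sub_cancel] at this
    exact this
  rw [Lrelax_eq, Lrelax_eq]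
  rcases hμ.eq_or_lt with rfl | hμ
  · by_cases hx' : ∀ j, 0 ≤ x'.2 j
    · rw [phi_zero hγ, phi_zero hx', add_zero, add_zero]
      have h4 : 0 ≤ ∑ j, v j * (x'.2 j - x.2 j) := Finset.sum_nonneg fun j _ => by
        rw [mul_sub, h3 j, sub_zero]
        exact mul_nonneg (hv j) (hx' j)
      have := key hx'
      exact_mod_cast (by linarith : Fobj D η w x ≤ Fobj D η w x')
    · rw [phi_zero_top hx', EReal.coe_add_top]; exact le_top
  · have hγ' : ∀ j, 0 < x.2 j := fun j => by
      refine lt_of_le_of_ne (hγ j) fun h0 => ?_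
      have := h3 j
      rw [← h0, mul_zero] at this
      linarith
    by_cases hx' : ∀ j, 0 < x'.2 j
    · rw [phi_pos hμ hγ', phi_pos hμ hx', ← EReal.coe_add, ← EReal.coe_add]
      have hk := key fun j => (hx' j).le
      have h4 : μ * ∑ j, Real.log (x'.2 j / μ) - μ * ∑ j, Real.log (x.2 j / μ) ≤
          ∑ j, v j * (x'.2 j - x.2 j) := by
        rw [Finset.mul_sum, Finset.mul_sum, ← Finset.sum_sub_distrib]
        refine Finset.sum_le_sum fun j _ => ?_
        have a := hγ' j
        have b := hx' j
        rw [Real.log_div b.ne' hμ.ne', Real.log_div a.ne' hμ.ne']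
        have c := Real.log_le_sub_one_of_pos (div_pos b a)
        rw [Real.log_div b.ne' a.ne'] at c
        have e : v j * (x'.2 j - x.2 j) = μ * (x'.2 j / x.2 j - 1) := by
          rw [← h3 j]; field_simp
        rw [e]
        nlinarith
      exact_mod_cast (by linarith : Fobj D η w x + (-μ) * ∑ j, Real.log (x.2 j / μ) ≤
        Fobj D η w x' + (-μ) * ∑ j, Real.log (x'.2 j / μ))
    · rw [phi_pos_top hμ hx', EReal.coe_add_top]; exact le_top

end LMEaux

/-- optimality conditions. (β̂,γ̂) = S_{η,μ}(β̃,γ̃) iff γ̂ ≥ 0 and there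
is v̂ ≥ 0 with G_{η,μ}((β̂,γ̂,v̂),(β̃,γ̃)) = 0; such v̂ is unique and, when μ > 0,
v̂_j = μ/γ̂_j. -/
theorem optimality_conditions_for_inner_problem
    {m p q : ℕ} (hm : 0 < m) (hp : 0 < p) (hq : 0 < q)
    (D : LMEData m p q) (hn : ∀ i, 0 < D.n i) (hlam : ∀ i, (D.lam i).PosDef)
    (μ η : ℝ) (hμ : 0 ≤ μ) (hη : D.etabar < η)
    (w : Vec p × Vec q) (xhat : Vec p × Vec q) :
    ((∀ x' : Vec p × Vec q, D.Lrelax η μ xhat w ≤ D.Lrelax η μ x' w) ↔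
      ((∀ j, 0 ≤ xhat.2 j) ∧
        ∃ v : Vec q, (∀ j, 0 ≤ v j) ∧ D.Gmap η μ (xhat.1, xhat.2, v) w = 0)) ∧
    (∀ v v' : Vec q, (∀ j, 0 ≤ v j) → (∀ j, 0 ≤ v' j) →
      D.Gmap η μ (xhat.1, xhat.2, v) w = 0 → D.Gmap η μ (xhat.1, xhat.2, v') w = 0 →
        v = v') ∧
    (0 < μ → ∀ v : Vec q, (∀ j, 0 ≤ v j) → D.Gmap η μ (xhat.1, xhat.2, v) w = 0 →
      ∀ j, v j = μ / xhat.2 j) := by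
  refine ⟨⟨fun h => ?_, ?_⟩, ?_, ?_⟩
  · rcases hμ.eq_or_lt with h0 | h0
    · subst h0
      exact LMEaux.kkt_zero_of_min D hlam η w xhat h
    · exact LMEaux.kkt_pos_of_min D hlam η μ h0 w xhat h
  · rintro ⟨hγ, v, hv, hG⟩ x'
    exact LMEaux.min_of_kkt D hn hlam η μ hμ hη w xhat hγ v hv hG x'
  · intro v v' _ _ h h'
    rw [LMEaux.Gmap_zero_iff] at h h'
    exact h.2.1.symm.trans h'.2.1
  · intro h0 v _ h j
    rw [LMEaux.Gmap_zero_iff] at h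
    have h1 := h.2.2 j
    refine eq_div_of_mul_eq (fun h2 => ?_) h1
    rw [h2, mul_zero] at h1
    linarith
end
end

section
/- Let μ ≥ 0, η > η̄, (β̃,γ̃) ∈ ℝ^p × ℝ^q, and let (β̂,γ̂,v̂) ∈ ℝ^p × ℝ_+^q × ℝ_+^q satisfy G_{η,μ}((β̂,γ̂,v̂),(β̃,γ̃)) = 0. Then the Jacobian of G_{η,μ} with respect to (β,γ,v) at (β̂,γ̂,v̂), namely the block matrix [[∇²_{ββ}L(β̂,γ̂)+ηI_p, ∇²_{γβ}L(β̂,γ̂), 0], [∇²_{βγ}L(β̂,γ̂), ∇²_{γγ}L(β̂,γ̂)+ηI_q, −I_q], [0, Diag(v̂), Diag(γ̂)]], is invertible if and only if v̂_j + γ̂_j > 0 for every j = 1,…,q (strict complementary slackness); in particular it is invertible whenever μ > 0. -/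
open Matrix Real Filter Topology Bornology
open scoped Pointwise

noncomputable section

section helpers

variable {E : Type*} [NormedAddCommGroup E] [NormedSpace ℝ E]

lemma dif_det {n : ℕ} {M : E → Matrix (Fin n) (Fin n) ℝ} {x : E}
    (h : ∀ a b, DifferentiableAt ℝ (fun y => M y a b) x) :
    DifferentiableAt ℝ (fun y => (M y).det) x := by
  simp only [Matrix.det_apply']
  refine DifferentiableAt.fun_sum fun σ _ => ?_
  refine DifferentiableAt.const_mul ?_ _
  exact (HasFDerivAt.finsetProd (u := Finset.univ) (g := fun a y => M y (σ a) a)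
    (fun a _ => (h (σ a) a).hasFDerivAt)).differentiableAt

lemma dif_inv {n : ℕ} {M : E → Matrix (Fin n) (Fin n) ℝ} {x : E}
    (h : ∀ a b, DifferentiableAt ℝ (fun y => M y a b) x) (h0 : (M x).det ≠ 0) (a b : Fin n) :
    DifferentiableAt ℝ (fun y => (M y)⁻¹ a b) x := by
  simp only [Matrix.inv_def, Matrix.smul_apply, Ring.inverse_eq_inv', smul_eq_mul,
    Matrix.adjugate_apply]
  refine ((dif_det h).inv h0).mul (dif_det fun c d => ?_)
  by_cases hc : c = b
  · subst hc; simp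
  · simpa [Matrix.updateRow_ne hc] using h c d

lemma dif_mulVec {ι κ : Type*} [Fintype κ] {M : E → Matrix ι κ ℝ} {r : E → κ → ℝ} {x : E}
    (h : ∀ a b, DifferentiableAt ℝ (fun y => M y a b) x)
    (hr : ∀ a, DifferentiableAt ℝ (fun y => r y a) x) (a : ι) :
    DifferentiableAt ℝ (fun y => (M y *ᵥ r y) a) x := by
  simp only [Matrix.mulVec, dotProduct]
  exact DifferentiableAt.fun_sum fun c _ => (h a c).mul (hr c)

lemma dif_dot {κ : Type*} [Fintype κ] {s r : E → κ → ℝ} {x : E}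
    (h : ∀ a, DifferentiableAt ℝ (fun y => s y a) x)
    (hr : ∀ a, DifferentiableAt ℝ (fun y => r y a) x) :
    DifferentiableAt ℝ (fun y => (s y ⬝ᵥ r y)) x := by
  simp only [dotProduct]
  exact DifferentiableAt.fun_sum fun c _ => (h c).mul (hr c)

lemma dif_mul {ι κ τ : Type*} [Fintype κ] {M : E → Matrix ι κ ℝ} {N : E → Matrix κ τ ℝ} {x : E}
    (h : ∀ a b, DifferentiableAt ℝ (fun y => M y a b) x)
    (hr : ∀ a b, DifferentiableAt ℝ (fun y => N y a b) x) (a : ι) (b : τ) :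
    DifferentiableAt ℝ (fun y => (M y * N y) a b) x := by
  simp only [Matrix.mul_apply]
  exact DifferentiableAt.fun_sum fun c _ => (h a c).mul (hr c b)

lemma dif_trace {n : ℕ} {M : E → Matrix (Fin n) (Fin n) ℝ} {x : E}
    (h : ∀ a b, DifferentiableAt ℝ (fun y => M y a b) x) :
    DifferentiableAt ℝ (fun y => (M y).trace) x := by
  simp only [Matrix.trace, Matrix.diag]
  exact DifferentiableAt.fun_sum fun c _ => (h c c)

/-! One-dimensional derivative rules, entrywise. -/

lemma hd_mulVec {ι κ : Type*} [Fintype κ] {M : ℝ → Matrix ι κ ℝ} {r : ℝ → κ → ℝ} {x : ℝ}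
    {M' : Matrix ι κ ℝ} {r' : κ → ℝ}
    (h : ∀ a b, HasDerivAt (fun y => M y a b) (M' a b) x)
    (hr : ∀ a, HasDerivAt (fun y => r y a) (r' a) x) (a : ι) :
    HasDerivAt (fun y => (M y *ᵥ r y) a) ((M' *ᵥ r x + M x *ᵥ r') a) x := by
  simp only [Matrix.mulVec, dotProduct, Pi.add_apply, ← Finset.sum_add_distrib]
  exact HasDerivAt.fun_sum fun c _ => (h a c).mul (hr c)

lemma hd_dot {κ : Type*} [Fintype κ] {s r : ℝ → κ → ℝ} {x : ℝ} {s' r' : κ → ℝ}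
    (h : ∀ a, HasDerivAt (fun y => s y a) (s' a) x)
    (hr : ∀ a, HasDerivAt (fun y => r y a) (r' a) x) :
    HasDerivAt (fun y => (s y ⬝ᵥ r y)) (s' ⬝ᵥ r x + s x ⬝ᵥ r') x := by
  simp only [dotProduct, ← Finset.sum_add_distrib]
  exact HasDerivAt.fun_sum fun c _ => (h c).mul (hr c)

lemma hd_mul {ι κ τ : Type*} [Fintype κ] {M : ℝ → Matrix ι κ ℝ} {N : ℝ → Matrix κ τ ℝ} {x : ℝ}
    {M' : Matrix ι κ ℝ} {N' : Matrix κ τ ℝ}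
    (h : ∀ a b, HasDerivAt (fun y => M y a b) (M' a b) x)
    (hr : ∀ a b, HasDerivAt (fun y => N y a b) (N' a b) x) (a : ι) (b : τ) :
    HasDerivAt (fun y => (M y * N y) a b) ((M' * N x + M x * N') a b) x := by
  simp only [Matrix.mul_apply, Matrix.add_apply, ← Finset.sum_add_distrib]
  exact HasDerivAt.fun_sum fun c _ => (h a c).mul (hr c b)

lemma hd_trace {n : ℕ} {M : ℝ → Matrix (Fin n) (Fin n) ℝ} {M' : Matrix (Fin n) (Fin n) ℝ} {x : ℝ}
    (h : ∀ a b, HasDerivAt (fun y => M y a b) (M' a b) x) :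
    HasDerivAt (fun y => (M y).trace) M'.trace x := by
  simp only [Matrix.trace, Matrix.diag]
  exact HasDerivAt.fun_sum fun c _ => (h c c)

lemma hd_inv {n : ℕ} {M : ℝ → Matrix (Fin n) (Fin n) ℝ} {M' : Matrix (Fin n) (Fin n) ℝ} {x : ℝ}
    (h : ∀ a b, HasDerivAt (fun y => M y a b) (M' a b) x) (h0 : (M x).det ≠ 0) (a b : Fin n) :
    HasDerivAt (fun y => (M y)⁻¹ a b) ((-((M x)⁻¹ * M' * (M x)⁻¹)) a b) x := by
  have hd : ∀ a b, HasDerivAt (fun y => (M y)⁻¹ a b)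
      ((Matrix.of fun a b => deriv (fun y => (M y)⁻¹ a b) x) a b) x := fun a b =>
    (dif_inv (fun a b => (h a b).differentiableAt) h0 a b).hasDerivAt
  set N' : Matrix (Fin n) (Fin n) ℝ := Matrix.of fun a b => deriv (fun y => (M y)⁻¹ a b) x
  have hev : ∀ᶠ y in 𝓝 x, (M y).det ≠ 0 :=
    (dif_det (fun a b => (h a b).differentiableAt)).continuousAt.eventually_ne h0
  have h1 : M' * (M x)⁻¹ + M x * N' = 0 := by
    ext c d
    have h2 := hd_mul h hd c d
    have h3 : (fun y => (M y * (M y)⁻¹) c d) =ᶠ[𝓝 x] fun _ => (1 : Matrix (Fin n) (Fin n) ℝ) c d := by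
      filter_upwards [hev] with y hy
      rw [Matrix.mul_nonsing_inv _ (isUnit_iff_ne_zero.mpr hy)]
    exact (h2.congr_of_eventuallyEq h3.symm).unique (hasDerivAt_const x _)
  have h4 : N' = -((M x)⁻¹ * M' * (M x)⁻¹) := by
    have : (M x)⁻¹ * (M' * (M x)⁻¹ + M x * N') = 0 := by rw [h1, mul_zero]
    rw [mul_add, ← mul_assoc, ← mul_assoc, Matrix.nonsing_inv_mul _ (isUnit_iff_ne_zero.mpr h0),
      one_mul] at this
    exact (neg_eq_of_add_eq_zero_right this).symm
  rw [← h4]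
  exact hd a b

lemma hd_logdet {n : ℕ} (M A : Matrix (Fin n) (Fin n) ℝ) (h0 : M.det ≠ 0) :
    HasDerivAt (fun t : ℝ => Real.log (M + t • A).det) (M⁻¹ * A).trace 0 := by
  have e : ∀ t : ℝ, M + t • A = M * (1 + t • (M⁻¹ * A)) := fun t => by
    rw [mul_add, mul_one, Matrix.mul_smul, ← mul_assoc,
      Matrix.mul_nonsing_inv _ (isUnit_iff_ne_zero.mpr h0), one_mul]
  have hd : HasDerivAt (fun t : ℝ => (M + t • A).det) (M.det * (M⁻¹ * A).trace) 0 := by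
    have e2 : (fun t : ℝ => (M + t • A).det) = fun t : ℝ => M.det * (1 + (M⁻¹ * A).trace * t +
        (det (1 + (Polynomial.X : Polynomial ℝ) • (M⁻¹ * A).map Polynomial.C)).divX.divX.eval t
          * t ^ 2) := by
      funext t
      rw [e, Matrix.det_mul, Matrix.det_one_add_smul t]
    rw [e2]
    refine HasDerivAt.const_mul _ ?_
    set P := (det (1 + (Polynomial.X : Polynomial ℝ) • (M⁻¹ * A).map Polynomial.C)).divX.divX
    have h1 : HasDerivAt (fun t : ℝ => 1 + (M⁻¹ * A).trace * t) (M⁻¹ * A).trace 0 := by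
      simpa using ((hasDerivAt_id (0 : ℝ)).const_mul (M⁻¹ * A).trace).const_add 1
    have h2 := (P.hasDerivAt 0).mul ((hasDerivAt_id (0 : ℝ)).pow 2)
    exact (h1.add h2).congr_deriv (by simp)
  have := hd.log (by simpa using h0)
  simpa [mul_div_assoc, h0] using this

end helpers

section bounds

lemma eNorm_sq {ι : Type*} [Fintype ι] (x : ι → ℝ) : eNorm x ^ 2 = x ⬝ᵥ x := by
  rw [eNorm, Real.sq_sqrt (Finset.sum_nonneg fun _ _ => sq_nonneg _)]
  simp [dotProduct, sq]

lemma dot_self_nn {ι : Type*} [Fintype ι] (x : ι → ℝ) : 0 ≤ x ⬝ᵥ x := by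
  rw [← eNorm_sq]; exact sq_nonneg _

lemma eNorm_nonneg {ι : Type*} [Fintype ι] (x : ι → ℝ) : 0 ≤ eNorm x := Real.sqrt_nonneg _

lemma dot_le_eNorm {ι : Type*} [Fintype ι] (x y : ι → ℝ) : x ⬝ᵥ y ≤ eNorm x * eNorm y :=
  Real.sum_mul_le_sqrt_mul_sqrt _ _ _

lemma eNorm_eq_zero {ι : Type*} [Fintype ι] {x : ι → ℝ} (h : eNorm x = 0) : x = 0 := by
  have := eNorm_sq x
  rw [h] at this
  exact dotProduct_self_eq_zero.mp (by linarith)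

lemma eNorm_smul {ι : Type*} [Fintype ι] {c : ℝ} (hc : 0 ≤ c) (x : ι → ℝ) :
    eNorm (c • x) = c * eNorm x := by
  have : eNorm (c • x) ^ 2 = (c * eNorm x) ^ 2 := by
    rw [mul_pow, eNorm_sq, eNorm_sq]; simp; ring
  exact (sq_eq_sq₀ (eNorm_nonneg _) (mul_nonneg hc (eNorm_nonneg _))).mp this

lemma opNorm_set_nonempty {ι κ : Type*} [Fintype ι] [Fintype κ] (M : Matrix ι κ ℝ) :
    {c : ℝ | 0 ≤ c ∧ ∀ x : κ → ℝ, eNorm (M.mulVec x) ≤ c * eNorm x}.Nonempty := by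
  refine ⟨Real.sqrt (∑ a, eNorm (M a) ^ 2), Real.sqrt_nonneg _, fun x => ?_⟩
  refine (sq_le_sq₀ (eNorm_nonneg _) (mul_nonneg (Real.sqrt_nonneg _) (eNorm_nonneg _))).mp ?_
  rw [mul_pow, Real.sq_sqrt (Finset.sum_nonneg fun _ _ => sq_nonneg _), Finset.sum_mul, eNorm_sq,
    dotProduct]
  refine Finset.sum_le_sum fun a _ => ?_
  have h := Finset.sum_mul_sq_le_sq_mul_sq Finset.univ (M a) x
  have h1 : eNorm (M a) ^ 2 = ∑ i, M a i ^ 2 := by rw [eNorm_sq]; simp [dotProduct, sq]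
  have h2 : eNorm x ^ 2 = ∑ i, x i ^ 2 := by rw [eNorm_sq]; simp [dotProduct, sq]
  rw [h1, h2, ← sq]
  exact h

lemma opNorm_nonneg {ι κ : Type*} [Fintype ι] [Fintype κ] (M : Matrix ι κ ℝ) : 0 ≤ opNorm M :=
  Real.sInf_nonneg fun _ hc => hc.1

lemma opNorm_le {ι κ : Type*} [Fintype ι] [Fintype κ] (M : Matrix ι κ ℝ) (x : κ → ℝ) :
    eNorm (M *ᵥ x) ≤ opNorm M * eNorm x := by
  obtain ⟨c, hc⟩ := opNorm_set_nonempty M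
  rcases (eNorm_nonneg x).eq_or_lt with h | h
  · have := hc.2 x
    rw [← h] at this ⊢
    simpa using this
  · rw [← div_le_iff₀ h]
    refine le_csInf ⟨c, hc⟩ fun d hd => ?_
    rw [div_le_iff₀ h]
    exact hd.2 x

lemma opNorm_transpose_le {ι κ : Type*} [Fintype ι] [Fintype κ] (M : Matrix ι κ ℝ) (x : ι → ℝ) :
    eNorm (Mᵀ *ᵥ x) ≤ opNorm M * eNorm x := by
  have h1 : eNorm (Mᵀ *ᵥ x) ^ 2 ≤ eNorm (Mᵀ *ᵥ x) * (opNorm M * eNorm x) := by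
    calc eNorm (Mᵀ *ᵥ x) ^ 2 = x ⬝ᵥ (M *ᵥ (Mᵀ *ᵥ x)) := by
          rw [eNorm_sq, Matrix.dotProduct_mulVec x M (Mᵀ *ᵥ x), ← Matrix.mulVec_transpose]
      _ ≤ eNorm x * eNorm (M *ᵥ (Mᵀ *ᵥ x)) := dot_le_eNorm _ _
      _ ≤ eNorm x * (opNorm M * eNorm (Mᵀ *ᵥ x)) :=
          mul_le_mul_of_nonneg_left (opNorm_le _ _) (eNorm_nonneg _)
      _ = _ := by ring
  rcases (eNorm_nonneg (Mᵀ *ᵥ x)).eq_or_lt with h | h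
  · rw [← h]; exact mul_nonneg (opNorm_nonneg _) (eNorm_nonneg _)
  · rw [sq] at h1
    exact le_of_mul_le_mul_left h1 h

lemma minEig_spec {n : ℕ} (hn : 0 < n) {M : Matrix (Fin n) (Fin n) ℝ} (hM : M.PosDef) :
    0 < minEig M ∧ ∀ x, minEig M * eNorm x ^ 2 ≤ x ⬝ᵥ (M *ᵥ x) := by
  have hpos : ∀ x : Fin n → ℝ, x ≠ 0 → 0 < x ⬝ᵥ (M *ᵥ x) := fun x hx => by
    simpa using hM.dotProduct_mulVec_pos hx
  have hK : IsCompact {x : Fin n → ℝ | eNorm x = 1} := by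
    refine Metric.isCompact_of_isClosed_isBounded ?_ ?_
    · refine isClosed_eq ?_ continuous_const
      unfold eNorm; fun_prop
    · refine (Metric.isBounded_closedBall (x := (0 : Fin n → ℝ)) (r := 1)).subset fun x hx => ?_
      rw [mem_closedBall_zero_iff, pi_norm_le_iff_of_nonneg zero_le_one]
      intro j
      have h1 : ∑ i, x i ^ 2 = 1 := by
        have := eNorm_sq x
        rw [show eNorm x = 1 from hx] at this
        simp only [dotProduct, ← sq] at this
        linarith
      have h2 := Finset.single_le_sum (f := fun i => x i ^ 2) (fun i _ => sq_nonneg _)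
        (Finset.mem_univ j)
      rw [Real.norm_eq_abs]
      exact (sq_le_one_iff_abs_le_one _).mp (by simpa [h1] using h2)
  have hcont : Continuous fun x : Fin n → ℝ => x ⬝ᵥ (M *ᵥ x) := by
    simp only [dotProduct, Matrix.mulVec]; fun_prop
  have hset : {r : ℝ | ∃ x : Fin n → ℝ, eNorm x = 1 ∧ r = x ⬝ᵥ M.mulVec x} =
      (fun x : Fin n → ℝ => x ⬝ᵥ (M *ᵥ x)) '' {x : Fin n → ℝ | eNorm x = 1} := by
    ext r; simp [Set.mem_image, eq_comm]
  have hC := hK.image hcont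
  rw [← hset] at hC
  have hne : {r : ℝ | ∃ x : Fin n → ℝ, eNorm x = 1 ∧ r = x ⬝ᵥ M.mulVec x}.Nonempty := by
    refine ⟨_, Pi.single ⟨0, hn⟩ 1, ?_, rfl⟩
    have := eNorm_sq (Pi.single (⟨0, hn⟩ : Fin n) (1 : ℝ))
    simp at this
    rcases this with h | h
    · exact h
    · have := eNorm_nonneg (Pi.single (⟨0, hn⟩ : Fin n) (1 : ℝ)); linarith
  refine ⟨?_, fun x => ?_⟩
  · obtain ⟨x, hx, h⟩ := hC.sInf_mem hne
    rw [minEig, h]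
    refine hpos x ?_
    rintro rfl
    have h0 : eNorm (0 : Fin n → ℝ) ^ 2 = 0 := by rw [eNorm_sq]; simp
    rw [hx] at h0; norm_num at h0
  · rcases (eNorm_nonneg x).eq_or_lt with h | h
    · rw [eNorm_eq_zero h.symm]
      have h0 : eNorm (0 : Fin n → ℝ) ^ 2 = 0 := by rw [eNorm_sq]; simp
      rw [h0]; simp
    · have h1 : minEig M ≤ ((eNorm x)⁻¹ • x) ⬝ᵥ (M *ᵥ ((eNorm x)⁻¹ • x)) :=
        csInf_le hC.bddBelow ⟨_, by rw [eNorm_smul (by positivity), inv_mul_cancel₀ h.ne'], rfl⟩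
      rw [Matrix.mulVec_smul, smul_dotProduct, dotProduct_smul, smul_eq_mul, smul_eq_mul,
        ← mul_assoc, ← mul_inv, ← sq, inv_mul_eq_div, le_div_iff₀ (by positivity)] at h1
      exact h1

/-- The key trace estimate. -/
lemma trace_bound {n q : ℕ} (hn : 0 < n) {Lam Om : Matrix (Fin n) (Fin n) ℝ}
    (hL : Lam.PosDef) (hO : Om.PosDef) (hge : ∀ x, x ⬝ᵥ (Lam *ᵥ x) ≤ x ⬝ᵥ (Om *ᵥ x))
    (Z : Matrix (Fin n) (Fin q) ℝ) (g : Fin q → ℝ) :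
    (Om⁻¹ * (Z * diagonal g * Zᵀ) * Om⁻¹ * (Z * diagonal g * Zᵀ)).trace ≤
      ((minEig Lam) ^ 2)⁻¹ * opNorm Z ^ 4 * (g ⬝ᵥ g) := by
  obtain ⟨hm, hmin⟩ := minEig_spec hn hL
  have hdet : IsUnit Om.det := isUnit_iff_ne_zero.mpr hO.det_pos.ne'
  have hinv : ∀ x, eNorm (Om⁻¹ *ᵥ x) ≤ (minEig Lam)⁻¹ * eNorm x := fun x => by
    have e : Om *ᵥ (Om⁻¹ *ᵥ x) = x := by
      rw [Matrix.mulVec_mulVec, Matrix.mul_nonsing_inv _ hdet, Matrix.one_mulVec]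
    have h1 : minEig Lam * eNorm (Om⁻¹ *ᵥ x) ^ 2 ≤ eNorm (Om⁻¹ *ᵥ x) * eNorm x := by
      refine (hmin _).trans ((hge _).trans ?_)
      rw [e]; exact dot_le_eNorm _ _
    rw [inv_mul_eq_div, le_div_iff₀ hm]
    rcases (eNorm_nonneg (Om⁻¹ *ᵥ x)).eq_or_lt with h | h
    · rw [← h]; simpa using eNorm_nonneg x
    · refine le_of_mul_le_mul_left ?_ h
      linarith
  set W := Zᵀ * Om⁻¹ * Z with hW
  have hOs : Om⁻¹ᵀ = Om⁻¹ := by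
    have := hO.isHermitian.inv
    simpa [Matrix.IsHermitian, Matrix.conjTranspose_eq_transpose_of_trivial] using this
  have hWs : Wᵀ = W := by
    rw [hW]; simp [Matrix.transpose_mul, hOs, Matrix.mul_assoc]
  have hWs' : ∀ j k, W k j = W j k := fun j k => by
    conv_lhs => rw [← hWs]
    rfl
  have htr : (Om⁻¹ * (Z * diagonal g * Zᵀ) * Om⁻¹ * (Z * diagonal g * Zᵀ)).trace =
      ∑ j, ∑ k, g j * g k * W j k ^ 2 := by
    have : Om⁻¹ * (Z * diagonal g * Zᵀ) * Om⁻¹ * (Z * diagonal g * Zᵀ) =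
      (Om⁻¹ * Z * diagonal g) * (W * diagonal g * Zᵀ) := by
        simp only [hW, Matrix.mul_assoc]
    rw [this, Matrix.trace_mul_comm]
    have : W * diagonal g * Zᵀ * (Om⁻¹ * Z * diagonal g) = (W * diagonal g) * (W * diagonal g) := by
      simp only [hW, Matrix.mul_assoc]
    rw [this]
    simp only [Matrix.trace, Matrix.diag, Matrix.mul_apply (M := W * diagonal g),
      Matrix.mul_diagonal]
    refine Finset.sum_congr rfl fun j _ => Finset.sum_congr rfl fun k _ => ?_
    rw [hWs' j k]; ring
  have hcol : ∀ j, ∑ k, W j k ^ 2 ≤ ((minEig Lam) ^ 2)⁻¹ * opNorm Z ^ 4 := fun j => by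
    have e : W *ᵥ Pi.single j 1 = fun k => W j k := by
      funext k; simp [hWs' j k]
    have h1 : eNorm (W *ᵥ Pi.single j 1) ^ 2 = ∑ k, W j k ^ 2 := by
      rw [e, eNorm_sq]; simp [dotProduct, sq]
    have hs : eNorm (Pi.single j 1 : Fin q → ℝ) = 1 := by
      have h := eNorm_sq (Pi.single j (1 : ℝ))
      have h' := eNorm_nonneg (Pi.single j (1 : ℝ))
      simp at h
      rcases h with h | h <;> linarith
    rw [← h1]
    have h2 : eNorm (W *ᵥ Pi.single j 1) ≤ opNorm Z * ((minEig Lam)⁻¹ * opNorm Z) := by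
      rw [hW, ← Matrix.mulVec_mulVec, ← Matrix.mulVec_mulVec]
      refine (opNorm_transpose_le _ _).trans (mul_le_mul_of_nonneg_left ?_ (opNorm_nonneg _))
      refine (hinv _).trans (mul_le_mul_of_nonneg_left ?_ (by positivity))
      simpa [hs] using opNorm_le Z (Pi.single j 1)
    calc _ ≤ (opNorm Z * ((minEig Lam)⁻¹ * opNorm Z)) ^ 2 :=
          pow_le_pow_left₀ (eNorm_nonneg _) h2 2
      _ = _ := by rw [← inv_pow]; ring
  rw [htr]
  calc ∑ j, ∑ k, g j * g k * W j k ^ 2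
      ≤ ∑ j, ∑ k, (g j ^ 2 / 2 * W j k ^ 2 + g k ^ 2 / 2 * W k j ^ 2) := by
        refine Finset.sum_le_sum fun j _ => Finset.sum_le_sum fun k _ => ?_
        rw [hWs' j k]
        nlinarith [mul_nonneg (sq_nonneg (g j - g k)) (sq_nonneg (W j k))]
    _ = ∑ j, g j ^ 2 * ∑ k, W j k ^ 2 := by
        simp only [Finset.sum_add_distrib]
        rw [Finset.sum_comm (f := fun j k => g k ^ 2 / 2 * W k j ^ 2), ← Finset.sum_add_distrib]
        refine Finset.sum_congr rfl fun j _ => ?_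
        rw [← Finset.mul_sum]; ring
    _ ≤ ∑ j, g j ^ 2 * (((minEig Lam) ^ 2)⁻¹ * opNorm Z ^ 4) :=
        Finset.sum_le_sum fun j _ => mul_le_mul_of_nonneg_left (hcol j) (sq_nonneg _)
    _ = _ := by
        rw [← Finset.sum_mul, dotProduct, mul_comm]
        simp only [sq]

end bounds

section secondDeriv

lemma second_deriv {n : ℕ} {Om A : Matrix (Fin n) (Fin n) ℝ} (hO : Om.PosDef) (hA : Aᵀ = A)
    (r x : Fin n → ℝ) :
    ∃ s' : ℝ, HasDerivAt (fun t : ℝ =>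
      (1 : ℝ) / 2 * (-(x ⬝ᵥ ((Om + t • A)⁻¹ *ᵥ (r - t • x)))
          - (r - t • x) ⬝ᵥ ((Om + t • A)⁻¹ *ᵥ x))
      + ((1 : ℝ) / 2 * (-((r - t • x) ⬝ᵥ (((Om + t • A)⁻¹ * A * (Om + t • A)⁻¹) *ᵥ (r - t • x))))
        + (1 : ℝ) / 2 * ((Om + t • A)⁻¹ * A).trace)) s' 0 ∧
      -((1 : ℝ) / 2 * (Om⁻¹ * A * Om⁻¹ * A).trace) ≤ s' := by
  have hM : ∀ a b, HasDerivAt (fun t : ℝ => (Om + t • A) a b) (A a b) 0 := fun a b => by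
    simp only [Matrix.add_apply, Matrix.smul_apply, smul_eq_mul]
    simpa using ((hasDerivAt_id (0 : ℝ)).mul_const (A a b)).const_add (Om a b)
  have hr : ∀ a, HasDerivAt (fun t : ℝ => (r - t • x) a) ((-x) a) 0 := fun a => by
    simp only [Pi.sub_apply, Pi.smul_apply, smul_eq_mul, Pi.neg_apply]
    simpa using ((hasDerivAt_id (0 : ℝ)).mul_const (x a)).const_sub (r a)
  have hx : ∀ a, HasDerivAt (fun _ : ℝ => x a) ((0 : Fin n → ℝ) a) 0 := fun a =>
    hasDerivAt_const _ _
  have hAc : ∀ a b, HasDerivAt (fun _ : ℝ => A a b)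
      ((0 : Matrix (Fin n) (Fin n) ℝ) a b) 0 := fun a b => hasDerivAt_const _ _
  have hN := hd_inv hM (by simpa using hO.det_pos.ne')
  have hNA := hd_mul hN hAc
  have hNAN := hd_mul hNA hN
  have D1 := hd_dot hx (hd_mulVec hN hr)
  have D2 := hd_dot hr (hd_mulVec hN hx)
  have D3 := hd_dot hr (hd_mulVec hNAN hr)
  have D4 := hd_trace hNA
  refine ⟨_, ((D1.neg.sub D2).const_mul ((1 : ℝ) / 2)).add
    ((D3.neg.const_mul ((1 : ℝ) / 2)).add (D4.const_mul ((1 : ℝ) / 2))), ?_⟩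
  simp only [zero_smul, add_zero, sub_zero]
  have hNp : Om⁻¹.PosDef := hO.inv
  have hNs : Om⁻¹ᵀ = Om⁻¹ := by
    have := hNp.isHermitian
    simpa [Matrix.IsHermitian, Matrix.conjTranspose_eq_transpose_of_trivial] using this
  generalize Om⁻¹ = N at *
  -- symmetric bilinear form
  have sN : ∀ a b : Fin n → ℝ, a ⬝ᵥ (N *ᵥ b) = b ⬝ᵥ (N *ᵥ a) := fun a b => by
    rw [Matrix.dotProduct_mulVec, ← Matrix.mulVec_transpose, hNs, dotProduct_comm]
  have sA : ∀ a b : Fin n → ℝ, a ⬝ᵥ (A *ᵥ b) = b ⬝ᵥ (A *ᵥ a) := fun a b => by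
    rw [Matrix.dotProduct_mulVec, ← Matrix.mulVec_transpose, hA, dotProduct_comm]
  have hq : 0 ≤ (x + A *ᵥ (N *ᵥ r)) ⬝ᵥ (N *ᵥ (x + A *ᵥ (N *ᵥ r))) := by
    simpa using hNp.posSemidef.dotProduct_mulVec_nonneg (x + A *ᵥ (N *ᵥ r))
  simp only [Matrix.mulVec_add, add_dotProduct, dotProduct_add] at hq
  simp only [Matrix.add_mulVec, Matrix.neg_mulVec, Matrix.mulVec_neg, Matrix.neg_mul,
    Matrix.mul_neg, ← Matrix.mulVec_mulVec, mul_zero, zero_dotProduct, add_zero, zero_add,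
    dotProduct_add, dotProduct_neg, neg_dotProduct, Matrix.mulVec_zero, Matrix.trace_neg]
  have e1 : r ⬝ᵥ (N *ᵥ (A *ᵥ (N *ᵥ x))) = x ⬝ᵥ (N *ᵥ (A *ᵥ (N *ᵥ r))) := by
    rw [sN r, dotProduct_comm, sA, dotProduct_comm, sN x]
  have e2 : r ⬝ᵥ (N *ᵥ (A *ᵥ (N *ᵥ (A *ᵥ (N *ᵥ r))))) =
    (A *ᵥ (N *ᵥ r)) ⬝ᵥ (N *ᵥ (A *ᵥ (N *ᵥ r))) := by
    rw [sN r, dotProduct_comm, sA, dotProduct_comm]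
  have e3 := sN x (A *ᵥ (N *ᵥ r))
  linarith

end secondDeriv

section model

variable {m p q : ℕ} (D : LMEData m p q)

/-- Closed form of the directional derivative of `L` in `β`. -/
def dB (β : Vec p) (γ : Vec q) (b : Vec p) : ℝ :=
  ∑ i, (1 : ℝ) / 2 * (-((D.X i *ᵥ b) ⬝ᵥ ((D.Omega (diagonal γ) i)⁻¹ *ᵥ (D.y i - D.X i *ᵥ β)))
    - (D.y i - D.X i *ᵥ β) ⬝ᵥ ((D.Omega (diagonal γ) i)⁻¹ *ᵥ (D.X i *ᵥ b)))

/-- Closed form of the directional derivative of `L` in `γ`. -/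
def dG (β : Vec p) (γ : Vec q) (g : Vec q) : ℝ :=
  ∑ i, ((1 : ℝ) / 2 * (-((D.y i - D.X i *ᵥ β) ⬝ᵥ
      (((D.Omega (diagonal γ) i)⁻¹ * (D.Z i * diagonal g * (D.Z i)ᵀ) *
        (D.Omega (diagonal γ) i)⁻¹) *ᵥ (D.y i - D.X i *ᵥ β))))
    + (1 : ℝ) / 2 * ((D.Omega (diagonal γ) i)⁻¹ * (D.Z i * diagonal g * (D.Z i)ᵀ)).trace)

lemma Omega_line (γ g : Vec q) (t : ℝ) (i : Fin m) :
    D.Omega (diagonal (γ + t • g)) i =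
      D.Omega (diagonal γ) i + t • (D.Z i * diagonal g * (D.Z i)ᵀ) := by
  have : (diagonal (γ + t • g) : Matrix (Fin q) (Fin q) ℝ) = diagonal γ + t • diagonal g := by
    rw [← Matrix.diagonal_smul, Matrix.diagonal_add]; rfl
  rw [LMEData.Omega, LMEData.Omega, this, Matrix.mul_add, Matrix.add_mul, Matrix.mul_smul,
    Matrix.smul_mul]
  abel

lemma res_line (β b : Vec p) (t : ℝ) (i : Fin m) :
    D.y i - D.X i *ᵥ (β + t • b) = (D.y i - D.X i *ᵥ β) - t • (D.X i *ᵥ b) := by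
  rw [Matrix.mulVec_add, Matrix.mulVec_smul]; abel

variable {E : Type*} [NormedAddCommGroup E] [NormedSpace ℝ E]

lemma dif_Omega {f : E → Vec q} {x : E} (hf : DifferentiableAt ℝ f x) (i : Fin m)
    (a b : Fin (D.n i)) : DifferentiableAt ℝ (fun y => D.Omega (diagonal (f y)) i a b) x := by
  have hf' := differentiableAt_pi.mp hf
  simp only [LMEData.Omega, Matrix.add_apply]
  refine DifferentiableAt.add_const _ ?_
  refine dif_mul (M := fun y => D.Z i * diagonal (f y)) (N := fun _ => (D.Z i)ᵀ)
    (fun a b => dif_mul (M := fun _ => D.Z i) (N := fun y => diagonal (f y))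
      (fun a b => differentiableAt_const _) (fun c d => ?_) a b)
    (fun a b => differentiableAt_const _) a b
  by_cases h : c = d
  · subst h; simpa using hf' c
  · simp [Matrix.diagonal_apply_ne _ h]

lemma dif_res {f : E → Vec p} {x : E} (hf : DifferentiableAt ℝ f x) (i : Fin m)
    (a : Fin (D.n i)) : DifferentiableAt ℝ (fun y => (D.y i - D.X i *ᵥ f y) a) x := by
  simp only [Pi.sub_apply]
  exact DifferentiableAt.const_sub (dif_mulVec (M := fun _ => D.X i) (fun a b => differentiableAt_const _)
    (differentiableAt_pi.mp hf) a) _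

lemma fderivB (β : Vec p) (γ : Vec q) (b : Vec p) :
    fderiv ℝ (fun b => D.L b γ) β b = dB D β γ b := by
  have hdif : DifferentiableAt ℝ (fun b => D.L b γ) β := by
    unfold LMEData.L LMEData.LML
    refine DifferentiableAt.fun_sum fun i _ => DifferentiableAt.add_const _
      (DifferentiableAt.const_mul ?_ _)
    exact dif_dot (dif_res D differentiableAt_id i)
      (dif_mulVec (fun a b => differentiableAt_const _) (dif_res D differentiableAt_id i))
  have h1 : HasDerivAt (fun t : ℝ => D.L (β + t • b) γ) (fderiv ℝ (fun b => D.L b γ) β b) 0 :=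
    hdif.hasFDerivAt.hasLineDerivAt b
  refine h1.unique ?_
  unfold LMEData.L LMEData.LML dB
  simp only [res_line]
  refine HasDerivAt.fun_sum fun i _ => HasDerivAt.add_const _ (HasDerivAt.const_mul _ ?_)
  set r := D.y i - D.X i *ᵥ β
  set x := D.X i *ᵥ b
  have hr : ∀ a, HasDerivAt (fun t : ℝ => (r - t • x) a) ((-x) a) 0 := fun a => by
    simp only [Pi.sub_apply, Pi.smul_apply, smul_eq_mul, Pi.neg_apply]
    simpa using ((hasDerivAt_id (0 : ℝ)).mul_const (x a)).const_sub (r a)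
  have hN : ∀ a b, HasDerivAt (fun _ : ℝ => (D.Omega (diagonal γ) i)⁻¹ a b)
    ((0 : Matrix (Fin (D.n i)) (Fin (D.n i)) ℝ) a b) 0 := fun a b => hasDerivAt_const _ _
  refine (hd_dot hr (hd_mulVec hN hr)).congr_deriv ?_
  simp [Matrix.mulVec_neg]
  ring

lemma fderivG (β : Vec p) (γ : Vec q) (h0 : ∀ i, (D.Omega (diagonal γ) i).det ≠ 0) (g : Vec q) :
    fderiv ℝ (fun g => D.L β g) γ g = dG D β γ g := by
  have hdif : DifferentiableAt ℝ (fun g => D.L β g) γ := by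
    unfold LMEData.L LMEData.LML
    refine DifferentiableAt.fun_sum fun i _ => DifferentiableAt.add
      (DifferentiableAt.const_mul ?_ _) (DifferentiableAt.const_mul ?_ _)
    · exact dif_dot (fun a => differentiableAt_const _)
        (dif_mulVec (dif_inv (dif_Omega D differentiableAt_id i) (h0 i))
          (fun a => differentiableAt_const _))
    · exact (dif_det (dif_Omega D differentiableAt_id i)).log (h0 i)
  have h1 : HasDerivAt (fun t : ℝ => D.L β (γ + t • g)) (fderiv ℝ (fun g => D.L β g) γ g) 0 :=
    hdif.hasFDerivAt.hasLineDerivAt g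
  refine h1.unique ?_
  unfold LMEData.L LMEData.LML dG
  simp only [Omega_line]
  refine HasDerivAt.fun_sum fun i _ => HasDerivAt.add (HasDerivAt.const_mul _ ?_)
    (HasDerivAt.const_mul _ (hd_logdet _ _ (h0 i)))
  set r := D.y i - D.X i *ᵥ β
  set Om := D.Omega (diagonal γ) i with hOm
  set A := D.Z i * diagonal g * (D.Z i)ᵀ
  have hM : ∀ a b, HasDerivAt (fun t : ℝ => (Om + t • A) a b) (A a b) 0 := fun a b => by
    simp only [Matrix.add_apply, Matrix.smul_apply, smul_eq_mul]
    simpa using ((hasDerivAt_id (0 : ℝ)).mul_const (A a b)).const_add (Om a b)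
  have hr : ∀ a, HasDerivAt (fun _ : ℝ => r a) ((0 : Fin (D.n i) → ℝ) a) 0 := fun a =>
    hasDerivAt_const _ _
  have hN := hd_inv hM (by simpa using h0 i)
  refine (hd_dot hr (hd_mulVec hN hr)).congr_deriv ?_
  simp [Matrix.neg_mulVec]

lemma sum_single {k : ℕ} (f : Vec k →L[ℝ] ℝ) (b : Vec k) :
    b ⬝ᵥ (fun j => f (Pi.single j 1)) = f b := by
  conv_rhs => rw [← Finset.univ_sum_single b, map_sum]
  refine Finset.sum_congr rfl fun j _ => ?_
  rw [← smul_eq_mul, ← map_smul, ← Pi.single_smul, smul_eq_mul, mul_one]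

lemma dot_gradB (β : Vec p) (γ : Vec q) (b : Vec p) : b ⬝ᵥ D.gradB β γ = dB D β γ b := by
  rw [← fderivB]; exact sum_single _ _

lemma dot_gradG (β : Vec p) (γ : Vec q) (h0 : ∀ i, (D.Omega (diagonal γ) i).det ≠ 0) (g : Vec q) :
    g ⬝ᵥ D.gradG β γ = dG D β γ g := by
  rw [← fderivG D β γ h0]; exact sum_single _ _

lemma Omega_ge (hlam : ∀ i, (D.lam i).PosDef) (γ : Vec q) (hγ : ∀ j, 0 ≤ γ j) (i : Fin m) :
    (D.Omega (diagonal γ) i).PosDef ∧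
      ∀ x, x ⬝ᵥ (D.lam i *ᵥ x) ≤ x ⬝ᵥ (D.Omega (diagonal γ) i *ᵥ x) := by
  have h1 : (D.Z i * diagonal γ * (D.Z i)ᵀ).PosSemidef := by
    have := (Matrix.PosSemidef.diagonal hγ).mul_mul_conjTranspose_same (D.Z i)
    rwa [Matrix.conjTranspose_eq_transpose_of_trivial] at this
  refine ⟨Matrix.PosDef.posSemidef_add h1 (hlam i), fun x => ?_⟩
  rw [LMEData.Omega, Matrix.add_mulVec, dotProduct_add]
  have := h1.dotProduct_mulVec_nonneg x
  simp only [star_trivial] at this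
  linarith

lemma Gmap_dif (hlam : ∀ i, (D.lam i).PosDef) (η μ : ℝ) (w : Vec p × Vec q)
    (βh : Vec p) (γh vh : Vec q) (hγ : ∀ j, 0 ≤ γh j) :
    DifferentiableAt ℝ (fun x : Vec p × Vec q × Vec q => D.Gmap η μ x w) (βh, γh, vh) := by
  have h0 : ∀ i, (D.Omega (diagonal γh) i).det ≠ 0 := fun i =>
    (Omega_ge D hlam γh hγ i).1.det_pos.ne'
  have d1 : DifferentiableAt ℝ (fun x : Vec p × Vec q × Vec q => x.1) (βh, γh, vh) := by fun_prop
  have d2 : DifferentiableAt ℝ (fun x : Vec p × Vec q × Vec q => x.2.1) (βh, γh, vh) := by fun_prop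
  have d3 : DifferentiableAt ℝ (fun x : Vec p × Vec q × Vec q => x.2.2) (βh, γh, vh) := by fun_prop
  have hOi : ∀ i a b, DifferentiableAt ℝ (fun x : Vec p × Vec q × Vec q =>
      (D.Omega (diagonal x.2.1) i)⁻¹ a b) (βh, γh, vh) := fun i =>
    dif_inv (dif_Omega D d2 i) (h0 i)
  have hB : DifferentiableAt ℝ (fun x : Vec p × Vec q × Vec q => D.gradB x.1 x.2.1)
      (βh, γh, vh) := by
    refine differentiableAt_pi.mpr fun j => ?_
    have : (fun x : Vec p × Vec q × Vec q => D.gradB x.1 x.2.1 j) =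
        fun x => dB D x.1 x.2.1 (Pi.single j 1) := funext fun x => fderivB _ _ _ _
    rw [this]
    unfold dB
    refine DifferentiableAt.fun_sum fun i _ => DifferentiableAt.const_mul
      (DifferentiableAt.sub (DifferentiableAt.neg ?_) ?_) _
    · exact dif_dot (fun a => differentiableAt_const _) (dif_mulVec (hOi i) (dif_res D d1 i))
    · exact dif_dot (dif_res D d1 i) (dif_mulVec (hOi i) (fun a => differentiableAt_const _))
  have hGr : DifferentiableAt ℝ (fun x : Vec p × Vec q × Vec q => D.gradG x.1 x.2.1)
      (βh, γh, vh) := by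
    refine differentiableAt_pi.mpr fun j => ?_
    have hev : ∀ᶠ x : Vec p × Vec q × Vec q in 𝓝 (βh, γh, vh),
        ∀ i, (D.Omega (diagonal x.2.1) i).det ≠ 0 :=
      Filter.eventually_all.mpr fun i =>
        (dif_det (dif_Omega D d2 i)).continuousAt.eventually_ne (h0 i)
    have : (fun x : Vec p × Vec q × Vec q => D.gradG x.1 x.2.1 j) =ᶠ[𝓝 (βh, γh, vh)]
        fun x => dG D x.1 x.2.1 (Pi.single j 1) := by
      filter_upwards [hev] with x hx
      exact fderivG _ _ _ hx _
    refine DifferentiableAt.congr_of_eventuallyEq ?_ this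
    unfold dG
    refine DifferentiableAt.fun_sum fun i _ => DifferentiableAt.add (DifferentiableAt.const_mul
      (DifferentiableAt.neg ?_) _) (DifferentiableAt.const_mul ?_ _)
    · exact dif_dot (dif_res D d1 i) (dif_mulVec (dif_mul (dif_mul (hOi i)
        (fun a b => differentiableAt_const _)) (hOi i)) (dif_res D d1 i))
    · exact dif_trace (dif_mul (hOi i) (fun a b => differentiableAt_const _))
  unfold LMEData.Gmap
  refine DifferentiableAt.prodMk (hB.add ((d1.sub_const _).const_smul η))
    (DifferentiableAt.prodMk ((hGr.add ((d2.sub_const _).const_smul η)).sub d3) ?_)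
  exact differentiableAt_pi.mpr fun j =>
    ((differentiableAt_pi.mp d3 j).mul (differentiableAt_pi.mp d2 j)).sub_const _

lemma nu_sum_le (i : Fin m) :
    (1 : ℝ) / 2 * ((minEig (D.lam i)) ^ 2)⁻¹ * (opNorm (D.Z i)) ^ 4 ≤ D.nu :=
  le_ciSup (f := fun i : Fin m =>
    (1 : ℝ) / 2 * ((minEig (D.lam i)) ^ 2)⁻¹ * (opNorm (D.Z i)) ^ 4)
    (Set.finite_range _).bddAbove i

/-- Description of the Jacobian. -/
lemma jac_spec (hn : ∀ i, 0 < D.n i) (hlam : ∀ i, (D.lam i).PosDef)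
    (η μ : ℝ) (w : Vec p × Vec q)
    (βh : Vec p) (γh vh : Vec q) (hγ : ∀ j, 0 ≤ γh j) (b : Vec p) (g u : Vec q)
    (J : Vec p × Vec q × Vec q)
    (hJ : fderiv ℝ (fun x : Vec p × Vec q × Vec q => D.Gmap η μ x w) (βh, γh, vh) (b, g, u) = J) :
    (∀ j, J.2.2 j = vh j * g j + u j * γh j) ∧
    η * (b ⬝ᵥ b) + (η - D.etabar) * (g ⬝ᵥ g) - g ⬝ᵥ u ≤ b ⬝ᵥ J.1 + g ⬝ᵥ J.2.1 := by
  have hline : HasDerivAt (fun t : ℝ => D.Gmap η μ ((βh, γh, vh) + t • (b, g, u)) w) J 0 := by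
    rw [← hJ]
    exact (Gmap_dif D hlam η μ w βh γh vh hγ).hasFDerivAt.hasLineDerivAt (b, g, u)
  have h1 : HasDerivAt (fun t : ℝ => (D.Gmap η μ ((βh, γh, vh) + t • (b, g, u)) w).1) J.1 0 :=
    (ContinuousLinearMap.fst ℝ (Vec p) (Vec q × Vec q)).hasFDerivAt.comp_hasDerivAt 0 hline
  have h2 : HasDerivAt (fun t : ℝ => (D.Gmap η μ ((βh, γh, vh) + t • (b, g, u)) w).2) J.2 0 :=
    (ContinuousLinearMap.snd ℝ (Vec p) (Vec q × Vec q)).hasFDerivAt.comp_hasDerivAt 0 hline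
  have h21 : HasDerivAt (fun t : ℝ => (D.Gmap η μ ((βh, γh, vh) + t • (b, g, u)) w).2.1)
      J.2.1 0 :=
    (ContinuousLinearMap.fst ℝ (Vec q) (Vec q)).hasFDerivAt.comp_hasDerivAt 0 h2
  have h22 : HasDerivAt (fun t : ℝ => (D.Gmap η μ ((βh, γh, vh) + t • (b, g, u)) w).2.2)
      J.2.2 0 :=
    (ContinuousLinearMap.snd ℝ (Vec q) (Vec q)).hasFDerivAt.comp_hasDerivAt 0 h2
  have lin : ∀ a c : ℝ, HasDerivAt (fun t : ℝ => a + t * c) c 0 := fun a c => by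
    simpa using ((hasDerivAt_id (0 : ℝ)).mul_const c).const_add a
  refine ⟨fun j => ?_, ?_⟩
  · have h3 := hasDerivAt_pi.mp h22 j
    refine h3.unique ?_
    have := ((lin (vh j) (u j)).mul (lin (γh j) (g j))).sub_const μ
    refine this.congr_deriv ?_
    simp; ring
  · have hOm := fun i => Omega_ge D hlam γh hγ i
    have hA : ∀ i, (D.Z i * diagonal g * (D.Z i)ᵀ)ᵀ = D.Z i * diagonal g * (D.Z i)ᵀ := fun i => by
      simp [Matrix.transpose_mul, Matrix.mul_assoc]
    choose s hs hs' using fun i => second_deriv (hOm i).1 (hA i) (D.y i - D.X i *ᵥ βh) (D.X i *ᵥ b)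
    have hF : HasDerivAt (fun t : ℝ => b ⬝ᵥ (D.Gmap η μ ((βh, γh, vh) + t • (b, g, u)) w).1 +
        g ⬝ᵥ (D.Gmap η μ ((βh, γh, vh) + t • (b, g, u)) w).2.1) (b ⬝ᵥ J.1 + g ⬝ᵥ J.2.1) 0 := by
      have k1 := hd_dot (fun a => hasDerivAt_const (0 : ℝ) (b a)) (hasDerivAt_pi.mp h1)
      have k2 := hd_dot (fun a => hasDerivAt_const (0 : ℝ) (g a)) (hasDerivAt_pi.mp h21)
      refine (k1.add k2).congr_deriv ?_
      simp [dotProduct]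
    have hc : ContinuousAt (fun t : ℝ => γh + t • g) 0 := by fun_prop
    have dl : DifferentiableAt ℝ (fun t : ℝ => γh + t • g) 0 := by fun_prop
    have hev : ∀ᶠ t : ℝ in 𝓝 0, ∀ i, (D.Omega (diagonal (γh + t • g)) i).det ≠ 0 :=
      Filter.eventually_all.mpr fun i =>
        (dif_det (dif_Omega D dl i)).continuousAt.eventually_ne
          (by simpa using (hOm i).1.det_pos.ne')
    have hS := (HasDerivAt.fun_sum (u := Finset.univ) fun i _ => hs i).add
      ((lin (η * (b ⬝ᵥ (βh - w.1) + g ⬝ᵥ (γh - w.2))) (η * (b ⬝ᵥ b + g ⬝ᵥ g))).sub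
        (lin (g ⬝ᵥ vh) (g ⬝ᵥ u)))
    have heq : b ⬝ᵥ J.1 + g ⬝ᵥ J.2.1 = ∑ i, s i + (η * (b ⬝ᵥ b + g ⬝ᵥ g) - g ⬝ᵥ u) := by
      refine hF.unique (hS.congr_of_eventuallyEq ?_)
      filter_upwards [hev] with t ht
      have e1 := dot_gradB D (βh + t • b) (γh + t • g) b
      have e2 := dot_gradG D (βh + t • b) (γh + t • g) ht g
      simp only [dB, dG, res_line, Omega_line] at e1 e2
      simp only [LMEData.Gmap, Prod.fst_add, Prod.snd_add, Prod.smul_fst, Prod.smul_snd,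
        Pi.add_apply, Pi.sub_apply, dotProduct_add, dotProduct_sub, dotProduct_smul, smul_eq_mul,
        Finset.sum_add_distrib] at e1 e2 ⊢
      rw [e1, e2]
      ring
    rw [heq]
    have hb : ∀ i, -(D.nu * (g ⬝ᵥ g)) ≤ s i := fun i => by
      have t1 := trace_bound (hn i) (hlam i) (hOm i).1 (hOm i).2 (D.Z i) g
      have t2 := mul_le_mul_of_nonneg_right (nu_sum_le D i) (dot_self_nn g)
      have t3 := hs' i
      linarith
    have hsum : -(D.etabar * (g ⬝ᵥ g)) ≤ ∑ i, s i := by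
      have := Finset.sum_le_sum (s := Finset.univ) fun i (_ : i ∈ Finset.univ) => hb i
      simp only [Finset.sum_const, Finset.card_univ, Fintype.card_fin, nsmul_eq_mul] at this
      rw [LMEData.etabar]
      linarith
    linarith

lemma jac_snd (hlam : ∀ i, (D.lam i).PosDef) (η μ : ℝ) (w : Vec p × Vec q)
    (βh : Vec p) (γh vh : Vec q) (hγ : ∀ j, 0 ≤ γh j) (u : Vec q)
    (J : Vec p × Vec q × Vec q)
    (hJ : fderiv ℝ (fun x : Vec p × Vec q × Vec q => D.Gmap η μ x w) (βh, γh, vh) (0, 0, u) = J) :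
    J.2.1 = -u := by
  have hline : HasDerivAt (fun t : ℝ => D.Gmap η μ ((βh, γh, vh) + t • (0, 0, u)) w) J 0 := by
    rw [← hJ]
    exact (Gmap_dif D hlam η μ w βh γh vh hγ).hasFDerivAt.hasLineDerivAt (0, 0, u)
  have h2 : HasDerivAt (fun t : ℝ => (D.Gmap η μ ((βh, γh, vh) + t • (0, 0, u)) w).2) J.2 0 :=
    (ContinuousLinearMap.snd ℝ (Vec p) (Vec q × Vec q)).hasFDerivAt.comp_hasDerivAt 0 hline
  have h21 : HasDerivAt (fun t : ℝ => (D.Gmap η μ ((βh, γh, vh) + t • (0, 0, u)) w).2.1)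
      J.2.1 0 :=
    (ContinuousLinearMap.fst ℝ (Vec q) (Vec q)).hasFDerivAt.comp_hasDerivAt 0 h2
  refine h21.unique ?_
  simp only [LMEData.Gmap, Prod.fst_add, Prod.snd_add, Prod.smul_fst, Prod.smul_snd, smul_zero,
    add_zero]
  refine HasDerivAt.const_sub _ ?_
  simpa using ((hasDerivAt_id (0 : ℝ)).smul_const u).const_add vh

end model

/-- the Jacobian of G_{η,μ} with respect to (β,γ,v) at a zero
(β̂,γ̂,v̂) is invertible iff strict complementary slackness holds; in particular it
is invertible whenever μ > 0. -/
theorem jacobian_invertible_iff_strict_complementarity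
    {m p q : ℕ} (hm : 0 < m) (hp : 0 < p) (hq : 0 < q)
    (D : LMEData m p q) (hn : ∀ i, 0 < D.n i) (hlam : ∀ i, (D.lam i).PosDef)
    (μ η : ℝ) (hμ : 0 ≤ μ) (hη : D.etabar < η)
    (w : Vec p × Vec q) (βh : Vec p) (γh vh : Vec q)
    (hγ : ∀ j, 0 ≤ γh j) (hv : ∀ j, 0 ≤ vh j)
    (hG : D.Gmap η μ (βh, γh, vh) w = 0) :
    (Function.Bijective
        (⇑(fderiv ℝ (fun x : Vec p × Vec q × Vec q => D.Gmap η μ x w) (βh, γh, vh)))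
      ↔ ∀ j, 0 < vh j + γh j) ∧
    (0 < μ → Function.Bijective
        (⇑(fderiv ℝ (fun x : Vec p × Vec q × Vec q => D.Gmap η μ x w) (βh, γh, vh)))) := by
  have hnu : 0 ≤ D.nu := Real.iSup_nonneg fun i => by
    have := opNorm_nonneg (D.Z i)
    positivity
  have het : 0 ≤ D.etabar := mul_nonneg hnu (Nat.cast_nonneg m)
  have hη0 : 0 < η := het.trans_lt hη
  set J := fderiv ℝ (fun x : Vec p × Vec q × Vec q => D.Gmap η μ x w) (βh, γh, vh) with hJ
  have spec := jac_spec D hn hlam η μ w βh γh vh hγ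
  have key : (∀ j, 0 < vh j + γh j) → Function.Bijective ⇑J := by
    intro hsc
    have hinj : Function.Injective (J : (Vec p × Vec q × Vec q) →ₗ[ℝ] (Vec p × Vec q × Vec q)) := by
      rw [injective_iff_map_eq_zero]
      rintro ⟨b, g, u⟩ h0
      obtain ⟨s1, s2⟩ := spec b g u 0 h0
      simp only [Prod.snd_zero, Prod.fst_zero, Pi.zero_apply, dotProduct_zero, add_zero] at s1 s2
      have hgu : g ⬝ᵥ u ≤ 0 := by
        refine Finset.sum_nonpos fun j _ => ?_
        have h1 := s1 j
        rcases (hγ j).eq_or_lt with h | h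
        · have hvj : 0 < vh j := by have := hsc j; rw [← h] at this; linarith
          rw [← h] at h1
          have : g j = 0 := by
            have h2 : vh j * g j = 0 := by linarith
            exact (mul_eq_zero.mp h2).resolve_left hvj.ne'
          simp [this]
        · have h2 : γh j * (g j * u j) = -(vh j * g j ^ 2) := by linear_combination (-g j) * h1
          have h3 : 0 ≤ vh j * g j ^ 2 := mul_nonneg (hv j) (sq_nonneg _)
          by_contra hc
          push Not at hc
          have := mul_pos h hc
          linarith
      have hbb := dot_self_nn b
      have hgg := dot_self_nn g
      have hp1 := mul_nonneg hη0.le hbb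
      have hp2 := mul_nonneg (sub_pos.mpr hη).le hgg
      have hb : b = 0 := by
        have : η * (b ⬝ᵥ b) = 0 := by linarith
        exact dotProduct_self_eq_zero.mp ((mul_eq_zero.mp this).resolve_left hη0.ne')
      have hg : g = 0 := by
        have : (η - D.etabar) * (g ⬝ᵥ g) = 0 := by linarith
        exact dotProduct_self_eq_zero.mp ((mul_eq_zero.mp this).resolve_left (sub_pos.mpr hη).ne')
      subst hb hg
      have hu : u = 0 := by
        have h := jac_snd D hlam η μ w βh γh vh hγ u 0 h0
        simpa using h.symm
      rw [hu]; rfl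
    exact ⟨hinj, LinearMap.injective_iff_surjective.mp hinj⟩
  refine ⟨⟨fun hbij j => ?_, key⟩, fun hμ' => key fun j => ?_⟩
  · by_contra hc
    have hγj : γh j = 0 := by have := hγ j; have := hv j; linarith
    have hvj : vh j = 0 := by have := hγ j; have := hv j; linarith
    obtain ⟨⟨b, g, u⟩, h⟩ := hbij.2 (0, 0, Pi.single j 1)
    have := (spec b g u _ h).1 j
    simp [hγj, hvj] at this
  · have h := congrFun (congrArg (fun x => x.2.2) hG) j
    simp [LMEData.Gmap] at h
    have h1 := hγ j
    have h2 := hv j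
    rcases h2.eq_or_lt with h3 | h3
    · rw [← h3] at h; linarith
    · linarith
end
end

section
/- Let μ > 0 and η > η̄. For each (β̃,γ̃) ∈ ℝ^p × ℝ^q let Ŝ_{η,μ}(β̃,γ̃) denote the unique triple (β̂,γ̂,v̂) ∈ ℝ^p × ℝ_{++}^q × ℝ_{++}^q with G_{η,μ}((β̂,γ̂,v̂),(β̃,γ̃)) = 0 (whose first two components are S_{η,μ}(β̃,γ̃)). Then Ŝ_{η,μ} and S_{η,μ} are continuously differentiable on ℝ^p × ℝ^q, and the Jacobian of Ŝ_{η,μ} at (β̃,γ̃) equals η times the matrix formed by the first p+q columns of the inverse of the Jacobian of G_{η,μ} with respect to (β,γ,v) evaluated at (Ŝ_{η,μ}(β̃,γ̃), (β̃,γ̃)). -/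
open Matrix Real Filter Topology Bornology
open scoped Pointwise

noncomputable section

/-! ### Auxiliary lemmas -/

lemma aux_contDiffAt_det {V : Type*} [NormedAddCommGroup V] [NormedSpace ℝ V] {n : ℕ}
    {k : WithTop ℕ∞} {M : V → Matrix (Fin n) (Fin n) ℝ} {x : V}
    (hM : ∀ i j, ContDiffAt ℝ k (fun z => M z i j) x) :
    ContDiffAt ℝ k (fun z => (M z).det) x := by
  simp only [Matrix.det_apply]
  refine ContDiffAt.sum fun σ _ => ?_
  refine ContDiffAt.const_smul _ ?_
  exact contDiffAt_prod fun i _ => hM _ _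

lemma aux_contDiffAt_inv {V : Type*} [NormedAddCommGroup V] [NormedSpace ℝ V] {n : ℕ}
    {k : WithTop ℕ∞} {M : V → Matrix (Fin n) (Fin n) ℝ} {x : V}
    (hM : ∀ i j, ContDiffAt ℝ k (fun z => M z i j) x) (hd : (M x).det ≠ 0) (i j : Fin n) :
    ContDiffAt ℝ k (fun z => (M z)⁻¹ i j) x := by
  simp only [Matrix.inv_def, Matrix.smul_apply, Matrix.adjugate_apply, Ring.inverse_eq_inv',
    smul_eq_mul]
  refine ((aux_contDiffAt_det hM).inv hd).mul (aux_contDiffAt_det fun a b => ?_)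
  simp only [Matrix.updateRow_apply]
  split_ifs
  · exact contDiffAt_const
  · exact hM a b

section Line

variable {n : ℕ} {A E : Matrix (Fin n) (Fin n) ℝ}

lemma aux_line_entry (A E : Matrix (Fin n) (Fin n) ℝ) (t : ℝ) (i j : Fin n) :
    ContDiffAt ℝ 1 (fun t : ℝ => (A + t • E) i j) t := by
  simp only [Matrix.add_apply, Matrix.smul_apply, smul_eq_mul]
  fun_prop

lemma aux_hasDerivAt_inv {t : ℝ} (hd : (A + t • E).det ≠ 0) (i j : Fin n) :
    HasDerivAt (fun t : ℝ => (A + t • E)⁻¹ i j)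
      (-((A + t • E)⁻¹ * E * (A + t • E)⁻¹) i j) t := by
  have hcont : ∀ a b, ContinuousAt (fun t : ℝ => (A + t • E)⁻¹ a b) t := fun a b =>
    (aux_contDiffAt_inv (fun i j => aux_line_entry A E t i j) hd a b).continuousAt
  have hdet : ∀ᶠ s in 𝓝 t, (A + s • E).det ≠ 0 :=
    (aux_contDiffAt_det (fun i j => aux_line_entry A E t i j)).continuousAt.eventually_ne hd
  rw [hasDerivAt_iff_tendsto_slope]
  have hlim : Tendsto (fun s : ℝ => -((A + s • E)⁻¹ * E * (A + t • E)⁻¹) i j) (𝓝[≠] t)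
      (𝓝 (-((A + t • E)⁻¹ * E * (A + t • E)⁻¹) i j)) := by
    refine Tendsto.mono_left ?_ nhdsWithin_le_nhds
    simp only [Matrix.mul_apply]
    refine Tendsto.neg (tendsto_finsetSum _ fun a _ => Tendsto.mul_const _ ?_)
    exact tendsto_finsetSum _ fun b _ => Tendsto.mul_const _ (hcont i b)
  refine hlim.congr' ?_
  filter_upwards [nhdsWithin_le_nhds hdet, self_mem_nhdsWithin] with s hs hne
  have hne' : s - t ≠ 0 := sub_ne_zero.2 hne
  have key : (A + s • E)⁻¹ - (A + t • E)⁻¹ = -(s - t) • ((A + s • E)⁻¹ * E * (A + t • E)⁻¹) := by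
    have h1 : (A + s • E)⁻¹ * (A + s • E) = 1 := Matrix.nonsing_inv_mul _ hs.isUnit
    have h2 : (A + t • E) * (A + t • E)⁻¹ = 1 := Matrix.mul_nonsing_inv _ hd.isUnit
    calc (A + s • E)⁻¹ - (A + t • E)⁻¹
        = (A + s • E)⁻¹ * ((A + t • E) * (A + t • E)⁻¹)
          - ((A + s • E)⁻¹ * (A + s • E)) * (A + t • E)⁻¹ := by rw [h1, h2]; simp
      _ = (A + s • E)⁻¹ * ((A + t • E) - (A + s • E)) * (A + t • E)⁻¹ := by noncomm_ring
      _ = _ := by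
        rw [show (A + t • E) - (A + s • E) = (-(s - t)) • E by module]
        simp
  have := congrFun (congrFun key i) j
  simp only [Matrix.sub_apply, Matrix.smul_apply, smul_eq_mul] at this
  rw [slope_def_field, this]
  field_simp

lemma aux_hasDerivAt_logdet {t : ℝ} (hd : (A + t • E).det ≠ 0) :
    HasDerivAt (fun t : ℝ => Real.log (A + t • E).det)
      (((A + t • E)⁻¹ * E).trace) t := by
  set B := A + t • E with hB
  have h0 : HasDerivAt (fun r : ℝ => (1 + r • (B⁻¹ * E)).det) ((B⁻¹ * E).trace) 0 := by
    have hfun : (fun r : ℝ => (1 + r • (B⁻¹ * E)).det) = fun r : ℝ =>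
        1 + (B⁻¹ * E).trace * r + ((1 + (Polynomial.X : Polynomial ℝ) •
          (B⁻¹ * E).map Polynomial.C).det.divX.divX).eval r * r ^ 2 :=
      funext fun r => Matrix.det_one_add_smul r (B⁻¹ * E)
    rw [hfun]
    have := (((hasDerivAt_id (0 : ℝ)).const_mul ((B⁻¹ * E).trace)).const_add 1).add
      (((((1 + (Polynomial.X : Polynomial ℝ) • (B⁻¹ * E).map Polynomial.C).det.divX.divX).hasDerivAt
        (0 : ℝ)).mul ((hasDerivAt_id (0 : ℝ)).pow 2)))
    refine (this.congr_deriv ?_)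
    simp
  have h1 : HasDerivAt (fun s : ℝ => (1 + (s - t) • (B⁻¹ * E)).det) ((B⁻¹ * E).trace) t := by
    have h0' : HasDerivAt (fun r : ℝ => (1 + r • (B⁻¹ * E)).det) ((B⁻¹ * E).trace) (t - t) := by
      simpa using h0
    simpa using HasDerivAt.comp_sub_const t t h0'
  have h2 : HasDerivAt (fun s : ℝ => (A + s • E).det) (B.det * (B⁻¹ * E).trace) t := by
    refine (h1.const_mul B.det).congr_of_eventuallyEq (Eventually.of_forall fun s => ?_)
    simp only
    rw [← Matrix.det_mul]
    congr 1
    rw [mul_add, mul_one, Matrix.mul_smul, ← mul_assoc, Matrix.mul_nonsing_inv _ hd.isUnit, one_mul,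
      hB]
    module
  have := h2.log hd
  refine this.congr_deriv ?_
  rw [← hB]
  field_simp

lemma aux_hasDerivAt_dot {u v : ℝ → Fin n → ℝ} {u' v' : Fin n → ℝ} {t : ℝ}
    (hu : HasDerivAt u u' t) (hv : HasDerivAt v v' t) :
    HasDerivAt (fun t => u t ⬝ᵥ v t) (u' ⬝ᵥ v t + u t ⬝ᵥ v') t := by
  rw [hasDerivAt_pi] at hu hv
  simp only [dotProduct, ← Finset.sum_add_distrib]
  exact HasDerivAt.fun_sum fun i _ => (hu i).mul (hv i)

lemma aux_hasDerivAt_mulVec (M : Matrix (Fin n) (Fin n) ℝ) {v : ℝ → Fin n → ℝ} {v' : Fin n → ℝ}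
    {t : ℝ} (hv : HasDerivAt v v' t) :
    HasDerivAt (fun t => M *ᵥ v t) (M *ᵥ v') t := by
  rw [hasDerivAt_pi]
  intro i
  have := aux_hasDerivAt_dot (hasDerivAt_const t (M i)) hv
  simpa [Matrix.mulVec] using this

lemma aux_hasDerivAt_sol (r s : Fin n → ℝ) {t : ℝ} (hd : (A + t • E).det ≠ 0) :
    HasDerivAt (fun t : ℝ => (A + t • E)⁻¹ *ᵥ (r - t • s))
      (-((A + t • E)⁻¹ *ᵥ (s + E *ᵥ ((A + t • E)⁻¹ *ᵥ (r - t • s))))) t := by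
  have hr : HasDerivAt (fun t : ℝ => r - t • s) (-s) t := by
    simpa using ((hasDerivAt_id t).smul_const s).const_sub r
  rw [hasDerivAt_pi]
  intro i
  have hW : HasDerivAt (fun t : ℝ => (A + t • E)⁻¹ i)
      ((-((A + t • E)⁻¹ * E * (A + t • E)⁻¹)) i) t := by
    rw [hasDerivAt_pi]
    exact fun j => aux_hasDerivAt_inv hd i j
  refine (aux_hasDerivAt_dot hW hr).congr_deriv ?_
  change ((-((A + t • E)⁻¹ * E * (A + t • E)⁻¹)) *ᵥ (r - t • s)) i
    + ((A + t • E)⁻¹ *ᵥ (-s)) i = _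
  rw [← Pi.add_apply]
  simp only [Matrix.neg_mulVec, Matrix.mulVec_neg, Matrix.mulVec_add, Matrix.mulVec_mulVec,
    Matrix.mul_assoc]
  rw [neg_add, add_comm]

/-- second derivative along a line of one block of the likelihood -/
lemma aux_block (hA : Aᵀ = A) (hE : Eᵀ = E) (r s : Fin n → ℝ) (hd : A.det ≠ 0) :
    ∃ f' : ℝ → ℝ, (∀ᶠ t in 𝓝 (0 : ℝ), HasDerivAt (fun t : ℝ =>
        (1 : ℝ) / 2 * ((r - t • s) ⬝ᵥ ((A + t • E)⁻¹ *ᵥ (r - t • s)))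
          + (1 : ℝ) / 2 * Real.log (A + t • E).det) (f' t) t) ∧
      HasDerivAt f' ((s + E *ᵥ (A⁻¹ *ᵥ r)) ⬝ᵥ (A⁻¹ *ᵥ (s + E *ᵥ (A⁻¹ *ᵥ r)))
        - (1 : ℝ) / 2 * (A⁻¹ * E * A⁻¹ * E).trace) 0 := by
  have hd0 : (A + (0 : ℝ) • E).det ≠ 0 := by simpa using hd
  have hdet : ∀ᶠ t in 𝓝 (0 : ℝ), (A + t • E).det ≠ 0 :=
    (aux_contDiffAt_det (fun i j => aux_line_entry A E 0 i j)).continuousAt.eventually_ne hd0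
  have sym : ∀ (M : Matrix (Fin n) (Fin n) ℝ), Mᵀ = M → ∀ a b : Fin n → ℝ,
      a ⬝ᵥ (M *ᵥ b) = (M *ᵥ a) ⬝ᵥ b := by
    intro M hM a b
    rw [Matrix.dotProduct_mulVec, ← Matrix.mulVec_transpose, hM]
  refine ⟨fun t => (1 : ℝ) / 2 * (-2 * (s ⬝ᵥ ((A + t • E)⁻¹ *ᵥ (r - t • s)))
      - ((A + t • E)⁻¹ *ᵥ (r - t • s)) ⬝ᵥ (E *ᵥ ((A + t • E)⁻¹ *ᵥ (r - t • s))))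
      + (1 : ℝ) / 2 * ((A + t • E)⁻¹ * E).trace, ?_, ?_⟩
  · filter_upwards [hdet] with t ht
    have hr : HasDerivAt (fun t : ℝ => r - t • s) (-s) t := by
      simpa using ((hasDerivAt_id t).smul_const s).const_sub r
    refine (((aux_hasDerivAt_dot hr (aux_hasDerivAt_sol r s ht)).const_mul ((1 : ℝ) / 2)).add
      ((aux_hasDerivAt_logdet ht).const_mul ((1 : ℝ) / 2))).congr_deriv ?_
    have hsym : ((A + t • E)⁻¹)ᵀ = (A + t • E)⁻¹ := by
      rw [Matrix.transpose_nonsing_inv, Matrix.transpose_add, Matrix.transpose_smul, hA, hE]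
    rw [dotProduct_neg (r - t • s), sym _ hsym (r - t • s)]
    simp only [neg_dotProduct, dotProduct_add]
    rw [dotProduct_comm _ s]
    ring
  · have hx := aux_hasDerivAt_sol r s hd0
    have h1 := aux_hasDerivAt_dot (hasDerivAt_const (0 : ℝ) s) hx
    have h2 := aux_hasDerivAt_dot hx (aux_hasDerivAt_mulVec E hx)
    have h3 : HasDerivAt (fun t : ℝ => ((A + t • E)⁻¹ * E).trace)
        (-(A⁻¹ * E * A⁻¹ * E).trace) 0 := by
      simp only [Matrix.trace, Matrix.diag, Matrix.mul_apply (N := E), ← Finset.sum_neg_distrib]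
      refine HasDerivAt.fun_sum fun i _ => HasDerivAt.fun_sum fun j _ => ?_
      refine ((aux_hasDerivAt_inv hd0 i j).mul_const (E j i)).congr_deriv ?_
      simp [Matrix.mul_apply]
    refine ((((h1.const_mul (-2)).sub h2).const_mul ((1 : ℝ) / 2)).add
      (h3.const_mul ((1 : ℝ) / 2))).congr_deriv ?_
    simp only [zero_smul, add_zero, sub_zero]
    set x := A⁻¹ *ᵥ r
    set y := A⁻¹ *ᵥ (s + E *ᵥ x)
    rw [sym E hE x]
    simp only [neg_dotProduct, dotProduct_neg, add_dotProduct, zero_dotProduct]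
    rw [dotProduct_comm y (E *ᵥ x)]
    ring

end Line
section Norms

variable {n k : ℕ}

lemma aux_eNorm_nonneg (x : Fin n → ℝ) : 0 ≤ eNorm x := Real.sqrt_nonneg _

lemma aux_eNorm_sq (x : Fin n → ℝ) : eNorm x ^ 2 = ∑ j, x j ^ 2 :=
  Real.sq_sqrt (Finset.sum_nonneg fun _ _ => sq_nonneg _)

lemma aux_eNorm_sq_dot (x : Fin n → ℝ) : eNorm x ^ 2 = x ⬝ᵥ x := by
  rw [aux_eNorm_sq]
  simp only [dotProduct, sq]

lemma aux_eNorm_smul (c : ℝ) (hc : 0 ≤ c) (x : Fin n → ℝ) : eNorm (c • x) = c * eNorm x := by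
  unfold eNorm
  simp only [Pi.smul_apply, smul_eq_mul, mul_pow, ← Finset.mul_sum]
  rw [Real.sqrt_mul (sq_nonneg c), Real.sqrt_sq hc]

lemma aux_eNorm_eq_zero {x : Fin n → ℝ} (h : eNorm x = 0) : x = 0 := by
  have := aux_eNorm_sq_dot x
  rw [h] at this
  exact dotProduct_self_eq_zero.1 (by simpa using this.symm)

lemma aux_cs (x y : Fin n → ℝ) : x ⬝ᵥ y ≤ eNorm x * eNorm y :=
  Real.sum_mul_le_sqrt_mul_sqrt _ _ _

lemma aux_opNorm_nonempty (M : Matrix (Fin n) (Fin k) ℝ) :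
    {c : ℝ | 0 ≤ c ∧ ∀ x : Fin k → ℝ, eNorm (M.mulVec x) ≤ c * eNorm x}.Nonempty := by
  refine ⟨Real.sqrt (∑ i, ∑ j, M i j ^ 2), Real.sqrt_nonneg _, fun x => ?_⟩
  unfold eNorm
  have h0 : 0 ≤ ∑ i, ∑ j, M i j ^ 2 :=
    Finset.sum_nonneg fun _ _ => Finset.sum_nonneg fun _ _ => sq_nonneg _
  rw [← Real.sqrt_mul h0]
  refine Real.sqrt_le_sqrt ?_
  rw [Finset.sum_mul]
  exact Finset.sum_le_sum fun i _ =>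
    Finset.sum_mul_sq_le_sq_mul_sq Finset.univ (fun j => M i j) x

lemma aux_opNorm_nonneg (M : Matrix (Fin n) (Fin k) ℝ) : 0 ≤ opNorm M :=
  le_csInf (aux_opNorm_nonempty M) fun _ hc => hc.1

lemma aux_opNorm_le (M : Matrix (Fin n) (Fin k) ℝ) (x : Fin k → ℝ) :
    eNorm (M *ᵥ x) ≤ opNorm M * eNorm x := by
  rcases (aux_eNorm_nonneg x).eq_or_lt with h | h
  · obtain ⟨c, -, hc⟩ := aux_opNorm_nonempty M
    have := hc x
    rw [← h] at this ⊢
    simpa using this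
  · rw [← div_le_iff₀ h]
    exact le_csInf (aux_opNorm_nonempty M) fun c hc => (div_le_iff₀ h).2 (hc.2 x)

lemma aux_opNorm_transpose_le (M : Matrix (Fin n) (Fin k) ℝ) (u : Fin n → ℝ) :
    eNorm (Mᵀ *ᵥ u) ≤ opNorm M * eNorm u := by
  have h1 : eNorm (Mᵀ *ᵥ u) ^ 2 ≤ eNorm u * (opNorm M * eNorm (Mᵀ *ᵥ u)) := by
    rw [aux_eNorm_sq_dot]
    have : (Mᵀ *ᵥ u) ⬝ᵥ (Mᵀ *ᵥ u) = u ⬝ᵥ (M *ᵥ (Mᵀ *ᵥ u)) := by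
      rw [Matrix.dotProduct_mulVec u, Matrix.mulVec_transpose]
    rw [this]
    exact (aux_cs _ _).trans (mul_le_mul_of_nonneg_left (aux_opNorm_le _ _) (aux_eNorm_nonneg _))
  rcases (aux_eNorm_nonneg (Mᵀ *ᵥ u)).eq_or_lt with h | h
  · rw [← h]
    exact mul_nonneg (aux_opNorm_nonneg _) (aux_eNorm_nonneg _)
  · refine le_of_mul_le_mul_right ?_ h
    nlinarith

lemma aux_minEig {M : Matrix (Fin n) (Fin n) ℝ} (hn : 0 < n) (hM : M.PosDef) :
    0 < minEig M ∧ ∀ x, minEig M * eNorm x ^ 2 ≤ x ⬝ᵥ (M *ᵥ x) := by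
  have hpos : ∀ x : Fin n → ℝ, x ≠ 0 → 0 < x ⬝ᵥ (M *ᵥ x) := fun x hx => by
    simpa using hM.dotProduct_mulVec_pos hx
  have hpos' : ∀ x : Fin n → ℝ, 0 ≤ x ⬝ᵥ (M *ᵥ x) := fun x => by
    by_cases hx : x = 0
    · simp [hx]
    · exact (hpos x hx).le
  have hbdd : BddBelow {r : ℝ | ∃ x : Fin n → ℝ, eNorm x = 1 ∧ r = x ⬝ᵥ M.mulVec x} := by
    refine ⟨0, ?_⟩
    rintro r ⟨x, -, rfl⟩
    exact hpos' x
  have hcontN : Continuous (eNorm : (Fin n → ℝ) → ℝ) := by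
    unfold eNorm
    fun_prop
  have hcomp : IsCompact {x : Fin n → ℝ | eNorm x = 1} := by
    refine Metric.isCompact_of_isClosed_isBounded (isClosed_eq hcontN continuous_const) ?_
    refine (Metric.isBounded_closedBall (x := (0 : Fin n → ℝ)) (r := 1)).subset fun x hx => ?_
    rw [mem_closedBall_zero_iff, pi_norm_le_iff_of_nonneg zero_le_one]
    intro i
    have h1 : x i ^ 2 ≤ eNorm x ^ 2 := by
      rw [aux_eNorm_sq]
      exact Finset.single_le_sum (f := fun j => x j ^ 2) (fun _ _ => sq_nonneg _)
        (Finset.mem_univ i)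
    rw [show eNorm x = 1 from hx] at h1
    rw [Real.norm_eq_abs]
    exact abs_le_of_sq_le_sq' (by simpa using h1) zero_le_one |> abs_le.2
  have hne : {x : Fin n → ℝ | eNorm x = 1}.Nonempty := by
    refine ⟨Pi.single ⟨0, hn⟩ 1, ?_⟩
    simp [eNorm, Pi.single_apply]
  constructor
  · obtain ⟨x, hx, hmin⟩ := hcomp.exists_isMinOn hne
      (f := fun x => x ⬝ᵥ (M *ᵥ x)) (by
        simp only [dotProduct, Matrix.mulVec]
        fun_prop)
    have hx0 : x ≠ 0 := by
      rintro rfl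
      simp [eNorm] at hx
    refine (hpos x hx0).trans_le (le_csInf ⟨_, x, hx, rfl⟩ ?_)
    rintro r ⟨z, hz, rfl⟩
    exact hmin hz
  · intro x
    rcases (aux_eNorm_nonneg x).eq_or_lt with h | h
    · rw [← h]
      simpa using hpos' x
    · have hz : eNorm ((eNorm x)⁻¹ • x) = 1 := by
        rw [aux_eNorm_smul _ (inv_nonneg.2 h.le), inv_mul_cancel₀ h.ne']
      have := csInf_le hbdd ⟨_, hz, rfl⟩
      change minEig M ≤ _ at this
      rw [Matrix.mulVec_smul, dotProduct_smul, smul_dotProduct, smul_eq_mul, smul_eq_mul] at this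
      have h2 : 0 < eNorm x ^ 2 := by positivity
      calc minEig M * eNorm x ^ 2
          ≤ ((eNorm x)⁻¹ * ((eNorm x)⁻¹ * (x ⬝ᵥ (M *ᵥ x)))) * eNorm x ^ 2 :=
            mul_le_mul_of_nonneg_right this h2.le
        _ = _ := by field_simp

/-- The bound of the curvature of the log-determinant. -/
lemma aux_trace_bound {Lam : Matrix (Fin n) (Fin n) ℝ} (hn : 0 < n) (hL : Lam.PosDef)
    (Z : Matrix (Fin n) (Fin k) ℝ) (γ g : Fin k → ℝ) (hγ : ∀ j, 0 < γ j) :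
    (Z * Matrix.diagonal γ * Zᵀ + Lam).PosDef ∧
    ((Z * Matrix.diagonal γ * Zᵀ + Lam)⁻¹ * (Z * Matrix.diagonal g * Zᵀ) *
      (Z * Matrix.diagonal γ * Zᵀ + Lam)⁻¹ * (Z * Matrix.diagonal g * Zᵀ)).trace
      ≤ ((minEig Lam) ^ 2)⁻¹ * (opNorm Z) ^ 4 * ∑ j, g j ^ 2 := by
  have hpsd : (Z * Matrix.diagonal γ * Zᵀ).PosSemidef := by
    have := (Matrix.PosSemidef.diagonal (n := Fin k) (d := γ)
      (fun j => (hγ j).le)).mul_mul_conjTranspose_same Z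
    simpa using this
  have hpd : (Z * Matrix.diagonal γ * Zᵀ + Lam).PosDef := Matrix.PosDef.posSemidef_add hpsd hL
  refine ⟨hpd, ?_⟩
  set Om := Z * Matrix.diagonal γ * Zᵀ + Lam with hOm
  obtain ⟨hμ, hmin⟩ := aux_minEig hn hL
  have hinv : ∀ z, eNorm (Om⁻¹ *ᵥ z) ≤ (minEig Lam)⁻¹ * eNorm z := by
    intro z
    set u := Om⁻¹ *ᵥ z with hu
    have hz : Om *ᵥ u = z := by
      rw [hu, Matrix.mulVec_mulVec, Matrix.mul_nonsing_inv _ hpd.det_pos.ne'.isUnit,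
        Matrix.one_mulVec]
    have h1 : minEig Lam * eNorm u ^ 2 ≤ eNorm u * eNorm z := by
      refine (hmin u).trans (le_trans ?_ (aux_cs u z))
      rw [← hz, hOm, Matrix.add_mulVec, dotProduct_add]
      have : 0 ≤ u ⬝ᵥ ((Z * Matrix.diagonal γ * Zᵀ) *ᵥ u) := by
        simpa using hpsd.dotProduct_mulVec_nonneg u
      linarith
    rw [inv_mul_eq_div, le_div_iff₀ hμ]
    rcases (aux_eNorm_nonneg u).eq_or_lt with h | h
    · rw [← h]
      simpa using aux_eNorm_nonneg z
    · refine le_of_mul_le_mul_left ?_ h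
      nlinarith
  set B := Zᵀ * Om⁻¹ * Z with hB
  have hBsym : Bᵀ = B := by
    have : Omᵀ = Om := by simpa using hpd.isHermitian.eq
    rw [hB, Matrix.transpose_mul, Matrix.transpose_mul, Matrix.transpose_nonsing_inv, this,
      Matrix.transpose_transpose, Matrix.mul_assoc]
  set c := (minEig Lam)⁻¹ * opNorm Z ^ 2 with hc
  have hσ := aux_opNorm_nonneg Z
  have hc0 : 0 ≤ c := by positivity
  have hBn : ∀ x, eNorm (B *ᵥ x) ≤ c * eNorm x := by
    intro x
    have e : B *ᵥ x = Zᵀ *ᵥ (Om⁻¹ *ᵥ (Z *ᵥ x)) := by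
      simp [hB, Matrix.mulVec_mulVec, Matrix.mul_assoc]
    rw [e]
    calc _ ≤ opNorm Z * eNorm (Om⁻¹ *ᵥ (Z *ᵥ x)) := aux_opNorm_transpose_le _ _
      _ ≤ opNorm Z * ((minEig Lam)⁻¹ * eNorm (Z *ᵥ x)) :=
        mul_le_mul_of_nonneg_left (hinv _) hσ
      _ ≤ opNorm Z * ((minEig Lam)⁻¹ * (opNorm Z * eNorm x)) := by
        have := aux_opNorm_le Z x
        gcongr
      _ = _ := by rw [hc]; ring
  have hcol : ∀ j, ∑ i, B i j ^ 2 ≤ c ^ 2 := by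
    intro j
    have h1 := hBn (Pi.single j 1)
    have h2 : eNorm (Pi.single j (1 : ℝ) : Fin k → ℝ) = 1 := by
      simp [eNorm, Pi.single_apply]
    rw [h2, mul_one] at h1
    have h3 := pow_le_pow_left₀ (aux_eNorm_nonneg _) h1 2
    rw [aux_eNorm_sq] at h3
    simpa using h3
  have htr : (Om⁻¹ * (Z * Matrix.diagonal g * Zᵀ) * Om⁻¹ * (Z * Matrix.diagonal g * Zᵀ)).trace
      = ∑ i, ∑ j, B i j ^ 2 * (g i * g j) := by
    have e1 : Om⁻¹ * (Z * Matrix.diagonal g * Zᵀ) * Om⁻¹ * (Z * Matrix.diagonal g * Zᵀ)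
        = (Om⁻¹ * Z * Matrix.diagonal g * Zᵀ * Om⁻¹ * Z * Matrix.diagonal g) * Zᵀ := by
      simp only [Matrix.mul_assoc]
    have e2 : Zᵀ * (Om⁻¹ * Z * Matrix.diagonal g * Zᵀ * Om⁻¹ * Z * Matrix.diagonal g)
        = (B * Matrix.diagonal g) * (B * Matrix.diagonal g) := by
      simp only [hB, Matrix.mul_assoc]
    rw [e1, Matrix.trace_mul_comm, e2]
    simp only [Matrix.trace, Matrix.diag, Matrix.mul_apply (M := B * Matrix.diagonal g),
      Matrix.mul_diagonal]
    refine Finset.sum_congr rfl fun i _ => Finset.sum_congr rfl fun j _ => ?_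
    have : B j i = B i j := congrFun (congrFun hBsym i) j
    rw [this]
    ring
  rw [htr]
  have hsplit : ∑ i, ∑ j, B i j ^ 2 * (g i * g j) ≤ ∑ i, ∑ j, B i j ^ 2 * g j ^ 2 := by
    have hs : ∑ i, ∑ j, B i j ^ 2 * g i ^ 2 = ∑ i, ∑ j, B i j ^ 2 * g j ^ 2 := by
      rw [Finset.sum_comm]
      refine Finset.sum_congr rfl fun i _ => Finset.sum_congr rfl fun j _ => ?_
      have : B j i = B i j := congrFun (congrFun hBsym i) j
      rw [this]
    have h2 : 2 * ∑ i, ∑ j, B i j ^ 2 * (g i * g j)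
        ≤ ∑ i, ∑ j, B i j ^ 2 * g i ^ 2 + ∑ i, ∑ j, B i j ^ 2 * g j ^ 2 := by
      simp only [Finset.mul_sum, ← Finset.sum_add_distrib]
      refine Finset.sum_le_sum fun i _ => Finset.sum_le_sum fun j _ => ?_
      nlinarith [mul_nonneg (sq_nonneg (B i j)) (sq_nonneg (g i - g j))]
    linarith
  refine hsplit.trans ?_
  rw [Finset.sum_comm, Finset.mul_sum]
  refine Finset.sum_le_sum fun j _ => ?_
  rw [← Finset.sum_mul]
  have : ((minEig Lam) ^ 2)⁻¹ * (opNorm Z) ^ 4 = c ^ 2 := by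
    rw [hc]; field_simp
  rw [this]
  exact mul_le_mul_of_nonneg_right (hcol j) (sq_nonneg _)

end Norms
lemma aux_partial_fst {V W : Type*} [NormedAddCommGroup V] [NormedSpace ℝ V]
    [NormedAddCommGroup W] [NormedSpace ℝ W] {F : V × W → ℝ} {z : V × W}
    (hz : DifferentiableAt ℝ F z) (v : V) :
    fderiv ℝ (fun b => F (b, z.2)) z.1 v = fderiv ℝ F z (v, 0) := by
  have hz' : HasFDerivAt F (fderiv ℝ F z) (z.1, z.2) := hz.hasFDerivAt
  have hg : HasFDerivAt (fun b : V => (b, z.2))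
      ((ContinuousLinearMap.id ℝ V).prod (0 : V →L[ℝ] W)) z.1 :=
    (hasFDerivAt_id z.1).prodMk (hasFDerivAt_const z.2 z.1)
  have h : HasFDerivAt (fun b => F (b, z.2)) _ z.1 := HasFDerivAt.comp z.1 hz' hg
  rw [h.fderiv]
  simp

lemma aux_partial_snd {V W : Type*} [NormedAddCommGroup V] [NormedSpace ℝ V]
    [NormedAddCommGroup W] [NormedSpace ℝ W] {F : V × W → ℝ} {z : V × W}
    (hz : DifferentiableAt ℝ F z) (v : W) :
    fderiv ℝ (fun b => F (z.1, b)) z.2 v = fderiv ℝ F z (0, v) := by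
  have hz' : HasFDerivAt F (fderiv ℝ F z) (z.1, z.2) := hz.hasFDerivAt
  have hg : HasFDerivAt (fun b : W => (z.1, b))
      ((0 : W →L[ℝ] V).prod (ContinuousLinearMap.id ℝ W)) z.2 :=
    (hasFDerivAt_const z.1 z.2).prodMk (hasFDerivAt_id z.2)
  have h : HasFDerivAt (fun b => F (z.1, b)) _ z.2 := HasFDerivAt.comp z.2 hz' hg
  rw [h.fderiv]
  simp

lemma aux_line_deriv {V : Type*} [NormedAddCommGroup V] [NormedSpace ℝ V] {F : V → ℝ} {z h : V}
    (hsm : ContDiffAt ℝ 2 F z) {f' : ℝ → ℝ} {c : ℝ}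
    (h1 : ∀ᶠ t in 𝓝 (0 : ℝ), HasDerivAt (fun t : ℝ => F (z + t • h)) (f' t) t)
    (h2 : HasDerivAt f' c 0) : fderiv ℝ (fderiv ℝ F) z h h = c := by
  have hl : ∀ t : ℝ, HasDerivAt (fun t : ℝ => z + t • h) h t := fun t => by
    simpa using ((hasDerivAt_id t).smul_const h).const_add z
  have hl0 : z + (0 : ℝ) • h = z := by simp
  have hdiff : ∀ᶠ t in 𝓝 (0 : ℝ), DifferentiableAt ℝ F (z + t • h) := by
    have h1 : ∀ᶠ x in 𝓝 z, DifferentiableAt ℝ F x :=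
      (hsm.eventually (by simp)).mono fun x hx => hx.differentiableAt (by simp)
    have h2 : Tendsto (fun t : ℝ => z + t • h) (𝓝 0) (𝓝 z) := by
      simpa using (hl 0).continuousAt.tendsto
    exact h2.eventually h1
  have heq : (fun t : ℝ => fderiv ℝ F (z + t • h) h) =ᶠ[𝓝 0] f' := by
    filter_upwards [hdiff, h1] with t ht1 ht2
    have d1 : HasDerivAt (fun t : ℝ => F (z + t • h)) (fderiv ℝ F (z + t • h) h) t :=
      ht1.hasFDerivAt.comp_hasDerivAt t (hl t)
    exact d1.unique ht2
  have hd2 : HasFDerivAt (fderiv ℝ F) (fderiv ℝ (fderiv ℝ F) z) (z + (0 : ℝ) • h) := by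
    rw [hl0]
    exact ((hsm.fderiv_right (m := 1) (by norm_num)).differentiableAt (by simp)).hasFDerivAt
  have d3 : HasDerivAt (fun t : ℝ => fderiv ℝ F (z + t • h) h) (fderiv ℝ (fderiv ℝ F) z h h) 0 := by
    have h3 : HasDerivAt (fun t : ℝ => fderiv ℝ F (z + t • h)) (fderiv ℝ (fderiv ℝ F) z h) 0 :=
      HasFDerivAt.comp_hasDerivAt (0 : ℝ) hd2 (hl 0)
    simpa using h3.clm_apply (hasDerivAt_const (0 : ℝ) h)
  exact d3.unique (h2.congr_of_eventuallyEq heq)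

namespace LMEData

variable {m p q : ℕ}

lemma aux_Omega_posDef (D : LMEData m p q) (hn : ∀ i, 0 < D.n i) (hlam : ∀ i, (D.lam i).PosDef)
    (γ : Vec q) (hγ : ∀ j, 0 < γ j) (i : Fin m) : (D.Omega (Matrix.diagonal γ) i).PosDef :=
  (aux_trace_bound (hn i) (hlam i) (D.Z i) γ 0 hγ).1

lemma aux_contDiffAt_L (D : LMEData m p q) (hn : ∀ i, 0 < D.n i) (hlam : ∀ i, (D.lam i).PosDef)
    (z : Vec p × Vec q) (hγ : ∀ j, 0 < z.2 j) :
    ContDiffAt ℝ 2 (fun z : Vec p × Vec q => D.L z.1 z.2) z := by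
  unfold L LML
  refine ContDiffAt.sum fun i _ => ?_
  have hd := (D.aux_Omega_posDef hn hlam z.2 hγ i).det_pos.ne'
  have hO : ∀ a b, ContDiffAt ℝ 2
      (fun z : Vec p × Vec q => D.Omega (Matrix.diagonal z.2) i a b) z := by
    intro a b
    simp only [Omega, Matrix.add_apply, Matrix.mul_apply (N := (D.Z i)ᵀ), Matrix.mul_diagonal]
    fun_prop
  have hr : ∀ a, ContDiffAt ℝ 2 (fun z : Vec p × Vec q => (D.y i - D.X i *ᵥ z.1) a) z := by
    intro a
    simp only [Pi.sub_apply, Matrix.mulVec, dotProduct]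
    fun_prop
  refine ContDiffAt.add (contDiffAt_const.mul ?_)
    (contDiffAt_const.mul ((aux_contDiffAt_det hO).log hd))
  simp only [Matrix.mulVec.eq_1 (D.Omega _ i)⁻¹, dotProduct]
  refine ContDiffAt.sum fun a _ => (hr a).mul (ContDiffAt.sum fun b _ => ?_)
  exact (aux_contDiffAt_inv hO hd a b).mul (hr b)

lemma aux_nu_nonneg (D : LMEData m p q) : 0 ≤ D.nu := by
  refine Real.iSup_nonneg fun i => ?_
  have := aux_opNorm_nonneg (D.Z i)
  positivity

lemma aux_hess (D : LMEData m p q) (hn : ∀ i, 0 < D.n i) (hlam : ∀ i, (D.lam i).PosDef)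
    (z h : Vec p × Vec q) (hγ : ∀ j, 0 < z.2 j) :
    -D.etabar * ∑ j, h.2 j ^ 2
      ≤ fderiv ℝ (fderiv ℝ (fun z : Vec p × Vec q => D.L z.1 z.2)) z h h := by
  set F := fun z : Vec p × Vec q => D.L z.1 z.2 with hF
  have hsm := D.aux_contDiffAt_L hn hlam z hγ
  set A : ∀ i, Matrix (Fin (D.n i)) (Fin (D.n i)) ℝ := fun i => D.Omega (Matrix.diagonal z.2) i
    with hA
  set E : ∀ i, Matrix (Fin (D.n i)) (Fin (D.n i)) ℝ :=
    fun i => D.Z i * Matrix.diagonal h.2 * (D.Z i)ᵀ with hE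
  have hApd : ∀ i, (A i).PosDef := D.aux_Omega_posDef hn hlam z.2 hγ
  have hEs : ∀ i, (E i)ᵀ = E i := fun i => by
    simp [hE, Matrix.transpose_mul, Matrix.mul_assoc]
  have hAs : ∀ i, (A i)ᵀ = A i := fun i => by
    simpa using (hApd i).isHermitian.eq
  choose f' hf1 hf2 using fun i => aux_block (hAs i) (hEs i) (D.y i - D.X i *ᵥ z.1)
    (D.X i *ᵥ h.1) (hApd i).det_pos.ne'
  -- the restriction to the line
  have hline : ∀ t : ℝ, F (z + t • h) = ∑ i,
      ((1 : ℝ) / 2 * (((D.y i - D.X i *ᵥ z.1) - t • (D.X i *ᵥ h.1)) ⬝ᵥ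
        ((A i + t • E i)⁻¹ *ᵥ ((D.y i - D.X i *ᵥ z.1) - t • (D.X i *ᵥ h.1))))
          + (1 : ℝ) / 2 * Real.log (A i + t • E i).det) := by
    intro t
    have e1 : ∀ i, D.y i - D.X i *ᵥ (z + t • h).1
        = (D.y i - D.X i *ᵥ z.1) - t • (D.X i *ᵥ h.1) := by
      intro i
      rw [Prod.fst_add, Prod.smul_fst, Matrix.mulVec_add, Matrix.mulVec_smul]
      abel
    have e2 : ∀ i, D.Omega (Matrix.diagonal (z + t • h).2) i = A i + t • E i := by
      intro i
      have : Matrix.diagonal (z + t • h).2 = Matrix.diagonal z.2 + t • Matrix.diagonal h.2 := by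
        rw [← Matrix.diagonal_smul, Matrix.diagonal_add]
        rfl
      simp only [hA, hE, Omega]
      rw [this, Matrix.mul_add, Matrix.add_mul, Matrix.mul_smul, Matrix.smul_mul]
      abel
    simp only [hF, L, LML]
    refine Finset.sum_congr rfl fun i _ => ?_
    rw [e1, e2]
  have hval : fderiv ℝ (fderiv ℝ F) z h h = _ :=
    aux_line_deriv hsm (f' := fun t => ∑ i, f' i t) (by
      filter_upwards [eventually_all.2 hf1] with t ht2
      rw [funext hline]
      exact HasDerivAt.fun_sum fun i _ => ht2 i)
      (HasDerivAt.fun_sum (u := Finset.univ) fun i _ => hf2 i)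
  rw [hval]
  have hterm : ∀ i, -D.nu * ∑ j, h.2 j ^ 2 ≤
      (D.X i *ᵥ h.1 + E i *ᵥ ((A i)⁻¹ *ᵥ (D.y i - D.X i *ᵥ z.1))) ⬝ᵥ
        ((A i)⁻¹ *ᵥ (D.X i *ᵥ h.1 + E i *ᵥ ((A i)⁻¹ *ᵥ (D.y i - D.X i *ᵥ z.1))))
        - (1 : ℝ) / 2 * ((A i)⁻¹ * E i * (A i)⁻¹ * E i).trace := by
    intro i
    have h1 : ∀ x : Fin (D.n i) → ℝ, 0 ≤ x ⬝ᵥ ((A i)⁻¹ *ᵥ x) := fun x => by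
      simpa using (hApd i).inv.posSemidef.dotProduct_mulVec_nonneg x
    have h2 := (aux_trace_bound (hn i) (hlam i) (D.Z i) z.2 h.2 hγ).2
    have h3 : (1 : ℝ) / 2 * ((minEig (D.lam i)) ^ 2)⁻¹ * (opNorm (D.Z i)) ^ 4 ≤ D.nu :=
      le_ciSup (f := fun i : Fin m =>
        (1 : ℝ) / 2 * ((minEig (D.lam i)) ^ 2)⁻¹ * (opNorm (D.Z i)) ^ 4)
        (Set.finite_range _).bddAbove i
    have h4 : 0 ≤ ∑ j, h.2 j ^ 2 := Finset.sum_nonneg fun _ _ => sq_nonneg _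
    have h5 := mul_le_mul_of_nonneg_right h3 h4
    have h6 := h1 (D.X i *ᵥ h.1 + E i *ᵥ ((A i)⁻¹ *ᵥ (D.y i - D.X i *ᵥ z.1)))
    change ((A i)⁻¹ * E i * (A i)⁻¹ * E i).trace ≤ _ at h2
    linarith
  refine le_trans (le_of_eq ?_) (Finset.sum_le_sum fun i _ => hterm i)
  simp [etabar]
  ring

lemma aux_grad (D : LMEData m p q) {z : Vec p × Vec q}
    (hz : DifferentiableAt ℝ (fun z : Vec p × Vec q => D.L z.1 z.2) z) :
    (∀ j, D.gradB z.1 z.2 j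
      = fderiv ℝ (fun z : Vec p × Vec q => D.L z.1 z.2) z (Pi.single j 1, 0)) ∧
    (∀ j, D.gradG z.1 z.2 j
      = fderiv ℝ (fun z : Vec p × Vec q => D.L z.1 z.2) z (0, Pi.single j 1)) := by
  constructor
  · intro j
    exact aux_partial_fst (F := fun z : Vec p × Vec q => D.L z.1 z.2) hz _
  · intro j
    exact aux_partial_snd (F := fun z : Vec p × Vec q => D.L z.1 z.2) hz _

/-- the map `G` is continuously differentiable at points with positive `γ` and its derivative
is injective at points with positive `γ` and `v` -/
lemma aux_Gmap (D : LMEData m p q) (hn : ∀ i, 0 < D.n i) (hlam : ∀ i, (D.lam i).PosDef)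
    (μ η : ℝ) (hη : D.etabar < η) (w : Vec p × Vec q) (x : Vec p × Vec q × Vec q)
    (hγ : ∀ j, 0 < x.2.1 j) (hv : ∀ j, 0 < x.2.2 j) :
    ContDiffAt ℝ 1 (fun x => D.Gmap η μ x w) x ∧
    Function.Injective (fderiv ℝ (fun x => D.Gmap η μ x w) x) := by
  set F := fun z : Vec p × Vec q => D.L z.1 z.2 with hF
  set z : Vec p × Vec q := (x.1, x.2.1) with hz
  have hsm : ContDiffAt ℝ 2 F z := D.aux_contDiffAt_L hn hlam z hγ
  let P : (Vec p × Vec q × Vec q) →L[ℝ] Vec p × Vec q :=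
    (ContinuousLinearMap.fst ℝ (Vec p) (Vec q × Vec q)).prod
      ((ContinuousLinearMap.fst ℝ (Vec q) (Vec q)).comp
        (ContinuousLinearMap.snd ℝ (Vec p) (Vec q × Vec q)))
  have hP : ∀ x, P x = (x.1, x.2.1) := fun _ => rfl
  have hsm1 : ContDiffAt ℝ 1 (fderiv ℝ F) (P x) := hsm.fderiv_right (m := 1) (by norm_num)
  have hsm2 : ContDiffAt ℝ 1 (fun x => fderiv ℝ F (P x)) x := hsm1.comp x P.contDiff.contDiffAt
  have hev : ∀ᶠ x' in 𝓝 x, DifferentiableAt ℝ F (P x') := by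
    have h1 : ∀ᶠ y in 𝓝 (P x), DifferentiableAt ℝ F y :=
      (hsm.eventually (by simp)).mono fun x hx => hx.differentiableAt (by simp)
    exact P.continuous.continuousAt.eventually h1
  have heq : (fun x => D.Gmap η μ x w) =ᶠ[𝓝 x] fun x =>
      ((fun j => fderiv ℝ F (P x) (Pi.single j 1, 0) + η * (x.1 j - w.1 j),
        fun j => fderiv ℝ F (P x) (0, Pi.single j 1) + η * (x.2.1 j - w.2 j) - x.2.2 j,
        fun j => x.2.2 j * x.2.1 j - μ) : Vec p × Vec q × Vec q) := by
    filter_upwards [hev] with x' hx'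
    obtain ⟨h1, h2⟩ := D.aux_grad hx'
    refine Prod.ext ?_ (Prod.ext ?_ rfl)
    · funext j
      have := h1 j
      simp only [hP] at this
      simp [Gmap, this, hP, hF]
    · funext j
      have := h2 j
      simp only [hP] at this
      simp [Gmap, this, hP, hF]
  have hc : ContDiffAt ℝ 1 (fun x => D.Gmap η μ x w) x := by
    refine ContDiffAt.congr_of_eventuallyEq ?_ heq
    refine ContDiffAt.prodMk (contDiffAt_pi.2 fun j => ?_)
      (ContDiffAt.prodMk (contDiffAt_pi.2 fun j => ?_) (contDiffAt_pi.2 fun j => ?_))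
    · refine (hsm2.clm_apply contDiffAt_const).add ?_
      fun_prop
    · refine ContDiffAt.sub ((hsm2.clm_apply contDiffAt_const).add ?_) ?_ <;> fun_prop
    · fun_prop
  refine ⟨hc, ?_⟩
  rw [injective_iff_map_eq_zero]
  intro d hd
  set T := fderiv ℝ (fun x => D.Gmap η μ x w) x with hT
  have hTd : HasFDerivAt (fun x => D.Gmap η μ x w) T x :=
    (hc.differentiableAt (by simp)).hasFDerivAt
  have hTd' := hTd.congr_of_eventuallyEq heq.symm
  -- derivative along the line
  have hl : HasDerivAt (fun t : ℝ => x + t • d) d 0 := by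
    simpa using ((hasDerivAt_id (0 : ℝ)).smul_const d).const_add x
  have hl0 : x + (0 : ℝ) • d = x := by simp
  have hTl := HasFDerivAt.comp_hasDerivAt (0 : ℝ) (by rw [hl0]; exact hTd') hl
  rw [hd] at hTl
  set D2 := fderiv ℝ (fderiv ℝ F) z with hD2
  have hD2d : HasFDerivAt (fderiv ℝ F) D2 (P x) :=
    (hsm1.differentiableAt (by simp)).hasFDerivAt
  have hD2l : HasDerivAt (fun t : ℝ => fderiv ℝ F (P (x + t • d))) (D2 (P d)) 0 := by
    have h1 : HasDerivAt (fun t : ℝ => P (x + t • d)) (P d) 0 :=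
      P.hasFDerivAt.comp_hasDerivAt (0 : ℝ) hl
    exact HasFDerivAt.comp_hasDerivAt (0 : ℝ) (by rw [hl0]; exact hD2d) h1
  have hlin : ∀ a b : ℝ, HasDerivAt (fun t : ℝ => a + t * b) b 0 := fun a b => by
    simpa using ((hasDerivAt_id (0 : ℝ)).mul_const b).const_add a
  have c1 : ∀ j, D2 (P d) (Pi.single j 1, 0) + η * d.1 j = 0 := by
    intro j
    have h1 := hasDerivAt_pi.1 hTl.fst j
    have h2 := (hD2l.clm_apply (hasDerivAt_const (0 : ℝ)
      ((Pi.single j 1, 0) : Vec p × Vec q))).add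
        (((hlin (x.1 j) (d.1 j)).sub_const (w.1 j)).const_mul η)
    simpa using h2.unique h1
  have c2 : ∀ j, D2 (P d) (0, Pi.single j 1) + η * d.2.1 j - d.2.2 j = 0 := by
    intro j
    have h1 := hasDerivAt_pi.1 hTl.snd.fst j
    have h2 := ((hD2l.clm_apply (hasDerivAt_const (0 : ℝ)
      ((0, Pi.single j 1) : Vec p × Vec q))).add
        (((hlin (x.2.1 j) (d.2.1 j)).sub_const (w.2 j)).const_mul η)).sub
          (hlin (x.2.2 j) (d.2.2 j))
    simpa using h2.unique h1
  have c3 : ∀ j, d.2.2 j * x.2.1 j + x.2.2 j * d.2.1 j = 0 := by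
    intro j
    have h1 := hasDerivAt_pi.1 hTl.snd.snd j
    have h2 := ((hlin (x.2.2 j) (d.2.2 j)).mul (hlin (x.2.1 j) (d.2.1 j))).sub_const μ
    simpa using h2.unique h1
  have hquad : D2 (P d) (P d) = ∑ j, d.1 j * D2 (P d) (Pi.single j 1, 0)
      + ∑ j, d.2.1 j * D2 (P d) (0, Pi.single j 1) := by
    have e : P d = ∑ j, d.1 j • ((Pi.single j 1, 0) : Vec p × Vec q)
        + ∑ j, d.2.1 j • ((0, Pi.single j 1) : Vec p × Vec q) := by
      rw [hP]
      refine Prod.ext ?_ ?_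
      · funext k
        simp [Prod.fst_sum, Pi.single_apply]
      · funext k
        simp [Prod.snd_sum, Pi.single_apply]
    conv_lhs => rw [congrArg (D2 (P d)) e]
    simp only [map_add, map_sum, map_smul, smul_eq_mul]
  have hH := D.aux_hess hn hlam z (P d) hγ
  change -D.etabar * ∑ j, d.2.1 j ^ 2 ≤ D2 (P d) (P d) at hH
  have heb : 0 ≤ D.etabar := mul_nonneg D.aux_nu_nonneg (Nat.cast_nonneg _)
  have hηp : 0 < η := heb.trans_lt hη
  have hsum : D2 (P d) (P d) + η * ∑ j, d.1 j ^ 2 + η * ∑ j, d.2.1 j ^ 2 ≤ 0 := by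
    have s1 : ∑ j, d.1 j * D2 (P d) (Pi.single j 1, 0) = -(η * ∑ j, d.1 j ^ 2) := by
      rw [Finset.mul_sum, ← Finset.sum_neg_distrib]
      refine Finset.sum_congr rfl fun j _ => ?_
      rw [eq_neg_of_add_eq_zero_left (c1 j)]
      ring
    have s2 : ∑ j, d.2.1 j * D2 (P d) (0, Pi.single j 1) ≤ -(η * ∑ j, d.2.1 j ^ 2) := by
      rw [Finset.mul_sum, ← Finset.sum_neg_distrib]
      refine Finset.sum_le_sum fun j _ => ?_
      have e : D2 (P d) (0, Pi.single j 1) = d.2.2 j - η * d.2.1 j := by linarith [c2 j]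
      have hg := hγ j
      have e2 : d.2.2 j = -(x.2.2 j / x.2.1 j) * d.2.1 j := by
        field_simp
        linarith [c3 j]
      have e3 : 0 < x.2.2 j / x.2.1 j := div_pos (hv j) hg
      rw [e, e2]
      nlinarith [mul_nonneg e3.le (sq_nonneg (d.2.1 j))]
    rw [hquad]
    linarith
  have n1 : 0 ≤ ∑ j, d.1 j ^ 2 := Finset.sum_nonneg fun _ _ => sq_nonneg _
  have n2 : 0 ≤ ∑ j, d.2.1 j ^ 2 := Finset.sum_nonneg fun _ _ => sq_nonneg _
  have z2 : ∑ j, d.2.1 j ^ 2 = 0 := by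
    by_contra hne
    have : 0 < ∑ j, d.2.1 j ^ 2 := lt_of_le_of_ne n2 (Ne.symm hne)
    nlinarith [mul_nonneg hηp.le n1, mul_pos (sub_pos.2 hη) this]
  have z1 : ∑ j, d.1 j ^ 2 = 0 := by
    by_contra hne
    have : 0 < ∑ j, d.1 j ^ 2 := lt_of_le_of_ne n1 (Ne.symm hne)
    rw [z2] at hH hsum
    nlinarith [mul_pos hηp this]
  have w1 : ∀ j, d.1 j = 0 := fun j => by
    have := (Finset.sum_eq_zero_iff_of_nonneg fun _ _ => sq_nonneg _).1 z1 j (Finset.mem_univ j)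
    exact pow_eq_zero_iff (two_ne_zero) |>.1 this
  have w2 : ∀ j, d.2.1 j = 0 := fun j => by
    have := (Finset.sum_eq_zero_iff_of_nonneg fun _ _ => sq_nonneg _).1 z2 j (Finset.mem_univ j)
    exact pow_eq_zero_iff (two_ne_zero) |>.1 this
  have w3 : ∀ j, d.2.2 j = 0 := fun j => by
    have := c3 j
    rw [w2 j, mul_zero, add_zero] at this
    exact (mul_eq_zero.1 this).resolve_right (hγ j).ne'
  exact Prod.ext (funext w1) (Prod.ext (funext w2) (funext w3))

end LMEData

/-- differentiability of the solution mappings Ŝ_{η,μ} and S_{η,μ};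
the Jacobian of Ŝ_{η,μ} is η times the first p+q columns of the inverse Jacobian of
G_{η,μ}: applying the Jacobian of G to the Jacobian of Ŝ gives (η dβ̃, η dγ̃, 0). -/
theorem solution_map_differentiable
    {m p q : ℕ} (hm : 0 < m) (hp : 0 < p) (hq : 0 < q)
    (D : LMEData m p q) (hn : ∀ i, 0 < D.n i) (hlam : ∀ i, (D.lam i).PosDef)
    (μ η : ℝ) (hμ : 0 < μ) (hη : D.etabar < η)
    (S : Vec p × Vec q → Vec p × Vec q)
    (hS : ∀ w x' : Vec p × Vec q, D.Lrelax η μ (S w) w ≤ D.Lrelax η μ x' w)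
    (Shat : Vec p × Vec q → Vec p × Vec q × Vec q)
    (hShat : ∀ w : Vec p × Vec q,
      (∀ j, 0 < (Shat w).2.1 j) ∧ (∀ j, 0 < (Shat w).2.2 j) ∧
      D.Gmap η μ (Shat w) w = 0 ∧
      (∀ x : Vec p × Vec q × Vec q, (∀ j, 0 < x.2.1 j) → (∀ j, 0 < x.2.2 j) →
        D.Gmap η μ x w = 0 → x = Shat w) ∧
      (Shat w).1 = (S w).1 ∧ (Shat w).2.1 = (S w).2) :
    ContDiff ℝ 1 Shat ∧ ContDiff ℝ 1 S ∧
    ∀ w dw : Vec p × Vec q,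
      Function.Bijective
        (⇑(fderiv ℝ (fun x : Vec p × Vec q × Vec q => D.Gmap η μ x w) (Shat w))) ∧
      (fderiv ℝ (fun x : Vec p × Vec q × Vec q => D.Gmap η μ x w) (Shat w))
          ((fderiv ℝ Shat w) dw)
        = (η • dw.1, η • dw.2, 0) := by
  have hpos : ∀ w, ContDiffAt ℝ 1 (fun x => D.Gmap η μ x 0) (Shat w) ∧
      Function.Injective (fderiv ℝ (fun x => D.Gmap η μ x 0) (Shat w)) := fun w =>
    D.aux_Gmap hn hlam μ η hη 0 (Shat w) (hShat w).1 (hShat w).2.1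
  have hG : ∀ (w : Vec p × Vec q) x, D.Gmap η μ x w
      = D.Gmap η μ x 0 - ((η • w.1, η • w.2, 0) : Vec p × Vec q × Vec q) := by
    intro w x
    refine Prod.ext ?_ (Prod.ext ?_ ?_)
    · funext j
      simp [LMEData.Gmap]
      ring
    · funext j
      simp [LMEData.Gmap]
      ring
    · funext j
      simp [LMEData.Gmap]
  let J : (Vec p × Vec q) →L[ℝ] Vec p × Vec q × Vec q :=
    η • ((ContinuousLinearMap.fst ℝ (Vec p) (Vec q)).prod
      ((ContinuousLinearMap.snd ℝ (Vec p) (Vec q)).prod 0))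
  have hJ : ∀ w, J w = (η • w.1, η • w.2, 0) := fun w => by
    simp [J]
  have hzero : ∀ (w : Vec p × Vec q) x, D.Gmap η μ x w = 0 ↔ D.Gmap η μ x 0 = J w := by
    intro w x
    rw [hG w x, sub_eq_zero, hJ]
  have hsol : ∀ w, D.Gmap η μ (Shat w) 0 = J w := fun w => (hzero w _).1 (hShat w).2.2.1
  have hbij : ∀ w, Function.Bijective (fderiv ℝ (fun x => D.Gmap η μ x 0) (Shat w)) := by
    intro w
    refine ⟨(hpos w).2, ?_⟩
    exact LinearMap.injective_iff_surjective
      (f := (fderiv ℝ (fun x => D.Gmap η μ x 0) (Shat w)).toLinearMap) |>.1 (hpos w).2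
  have hC : ContDiff ℝ 1 Shat := by
    rw [contDiff_iff_contDiffAt]
    intro w
    obtain ⟨hc, hinj⟩ := hpos w
    let e : (Vec p × Vec q × Vec q) ≃L[ℝ] (Vec p × Vec q × Vec q) :=
      (LinearEquiv.ofBijective (fderiv ℝ (fun x => D.Gmap η μ x 0) (Shat w)).toLinearMap
        (hbij w)).toContinuousLinearEquiv
    have he : HasFDerivAt (fun x => D.Gmap η μ x 0)
        (e : (Vec p × Vec q × Vec q) →L[ℝ] (Vec p × Vec q × Vec q)) (Shat w) := by
      have : (e : (Vec p × Vec q × Vec q) →L[ℝ] (Vec p × Vec q × Vec q))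
          = fderiv ℝ (fun x => D.Gmap η μ x 0) (Shat w) := by
        exact ContinuousLinearMap.ext fun v => rfl
      rw [this]
      exact (hc.differentiableAt (by simp)).hasFDerivAt
    have hs := hc.hasStrictFDerivAt' he (by simp)
    have hinvC : ContDiffAt ℝ 1 (hs.localInverse _ e (Shat w)) (D.Gmap η μ (Shat w) 0) :=
      hc.to_localInverse he (by simp)
    rw [hsol w] at hinvC
    have hcomp : ContDiffAt ℝ 1 (fun w' => hs.localInverse _ e (Shat w) (J w')) w :=
      hinvC.comp w J.contDiff.contDiffAt
    refine hcomp.congr_of_eventuallyEq ?_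
    have hright : ∀ᶠ w' in 𝓝 w, D.Gmap η μ (hs.localInverse _ e (Shat w) (J w')) 0 = J w' := by
      have h1 := hs.eventually_right_inverse
      rw [hsol w] at h1
      exact J.continuous.continuousAt.eventually h1
    have hval : hs.localInverse _ e (Shat w) (J w) = Shat w := by
      rw [← hsol w]
      exact hs.localInverse_apply_image
    have hcont := hcomp.continuousAt
    have hopen : IsOpen {x : Vec p × Vec q × Vec q | (∀ j, 0 < x.2.1 j) ∧ ∀ j, 0 < x.2.2 j} := by
      simp only [Set.ofPred_and, Set.ofPred_forall]
      refine IsOpen.inter (isOpen_iInter_of_finite fun j => ?_)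
        (isOpen_iInter_of_finite fun j => ?_)
      · exact isOpen_lt continuous_const (by fun_prop)
      · exact isOpen_lt continuous_const (by fun_prop)
    have hmem := hcont.eventually_mem (hopen.mem_nhds (by
      rw [hval]
      exact ⟨(hShat w).1, (hShat w).2.1⟩))
    filter_upwards [hright, hmem] with w' h1 h2
    exact ((hShat w').2.2.2.1 _ h2.1 h2.2 ((hzero w' _).2 h1)).symm
  refine ⟨hC, ?_, ?_⟩
  · have : S = fun w => ((Shat w).1, (Shat w).2.1) := by
      funext w
      rw [(hShat w).2.2.2.2.1, (hShat w).2.2.2.2.2]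
    rw [this]
    exact hC.fst.prodMk hC.snd.fst
  · intro w dw
    have hfd : fderiv ℝ (fun x : Vec p × Vec q × Vec q => D.Gmap η μ x w) (Shat w)
        = fderiv ℝ (fun x => D.Gmap η μ x 0) (Shat w) := by
      rw [funext (hG w), fderiv_sub_const]
    rw [hfd]
    refine ⟨hbij w, ?_⟩
    have h1 : HasFDerivAt (fun x => D.Gmap η μ x 0)
        (fderiv ℝ (fun x => D.Gmap η μ x 0) (Shat w)) (Shat w) :=
      ((hpos w).1.differentiableAt (by simp)).hasFDerivAt
    have h2 := h1.comp w (hC.differentiable (by simp) w).hasFDerivAt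
    have h3 : ((fun x => D.Gmap η μ x 0) ∘ Shat) = J := funext hsol
    rw [h3] at h2
    have h4 := h2.unique J.hasFDerivAt
    have h5 := congrArg (fun T : (Vec p × Vec q) →L[ℝ] Vec p × Vec q × Vec q => T dw) h4
    simpa [hJ] using h5
end
end
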